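/- arXiv:1402.4199 — 4 statements merged into one kernel-verified Lean document; each statement's English description precedes it below -/
import Mathlib

section
/- Let X ⊆ ℝ^n be a finite set of points, let p be a polynomial of total degree at most 2s that is nonnegative at every point of X, and suppose that for some natural number k one has H_X(k+s) + H_X(k) > H_X(2k+2s). Then there exists a function h : X → ℝ that is k-sos on X and not identically zero on X such that the product p·h is (k+s)-sos on X (i.e., p is (k+s)-rsos on X). -/
/-- The hypercube `{0,1}^n ⊆ ℝ^n`. -/
def cube (n : ℕ) : Set (Fin n → ℝ) := {x | ∀ i, x i = 0 ∨ x i = 1}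

/-- `f` is `k`-sos on `X`: a finite sum of squares of polynomials of total degree ≤ `k`,
as a function on `X`. -/
def IsSosOn (n : ℕ) (X : Set (Fin n → ℝ)) (k : ℕ) (f : (Fin n → ℝ) → ℝ) : Prop :=
  ∃ (m : ℕ) (g : Fin m → MvPolynomial (Fin n) ℝ),
    (∀ i, (g i).totalDegree ≤ k) ∧ ∀ x ∈ X, f x = ∑ i, (MvPolynomial.eval x (g i)) ^ 2

/-- The Hilbert function of `X`: the dimension of the space of functions `X → ℝ`
that are restrictions of polynomials of total degree at most `t`. -/
noncomputable def hilbert (n : ℕ) (X : Set (Fin n → ℝ)) (t : ℕ) : ℕ :=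
  Module.finrank ℝ (Submodule.span ℝ
    {f : X → ℝ | ∃ p : MvPolynomial (Fin n) ℝ, p.totalDegree ≤ t ∧
      ∀ x : X, f x = MvPolynomial.eval (x : Fin n → ℝ) p})

open MvPolynomial in
/-- The span defining the Hilbert function consists of restrictions of polynomials. -/
theorem exists_poly_of_mem_span {n : ℕ} {X : Set (Fin n → ℝ)} {t : ℕ} {f : X → ℝ}
    (hf : f ∈ Submodule.span ℝ {f : X → ℝ | ∃ p : MvPolynomial (Fin n) ℝ, p.totalDegree ≤ t ∧
      ∀ x : X, f x = MvPolynomial.eval (x : Fin n → ℝ) p}) :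
    ∃ p : MvPolynomial (Fin n) ℝ, p.totalDegree ≤ t ∧
      ∀ x : X, f x = MvPolynomial.eval (x : Fin n → ℝ) p := by
  induction hf using Submodule.span_induction with
  | mem f hf => exact hf
  | zero => exact ⟨0, by simp, by simp⟩
  | add f g _ _ hf hg =>
    obtain ⟨p, hp, hfp⟩ := hf
    obtain ⟨q, hq, hgq⟩ := hg
    exact ⟨p + q, (totalDegree_add p q).trans (max_le hp hq), fun x => by simp [hfp, hgq]⟩
  | smul c f _ hf =>
    obtain ⟨p, hp, hfp⟩ := hf
    exact ⟨c • p, (totalDegree_smul_le c p).trans hp, fun x => by simp [hfp, smul_eval]⟩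

/-- A finite-dimensional space of functions is determined by its values at
at most as many points as its dimension. -/
theorem exists_determining_points {α : Type*} [Finite α] (V : Submodule ℝ (α → ℝ)) :
    ∃ (d : ℕ) (y : Fin d → α), d ≤ Module.finrank ℝ V ∧
      ∀ f ∈ V, (∀ i, f (y i) = 0) → f = 0 := by
  let ev : α → Module.Dual ℝ V := fun a => (LinearMap.proj a).comp V.subtype
  obtain ⟨b, hb, hspan, -⟩ := Submodule.exists_fun_fin_finrank_span_eq ℝ (Set.range ev)
  choose y hy using hb
  refine ⟨_, y, (Submodule.finrank_le _).trans_eq Subspace.dual_finrank_eq, fun f hf h0 => ?_⟩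
  have hle : Submodule.span ℝ (Set.range b) ≤
      LinearMap.ker (Module.Dual.eval ℝ V ⟨f, hf⟩) := by
    rw [Submodule.span_le]
    rintro _ ⟨i, rfl⟩
    simpa [← hy, ev] using h0 i
  rw [hspan, Submodule.span_le] at hle
  ext a
  simpa [ev] using hle ⟨a, rfl⟩

/-- If two spaces of functions have total dimension larger than the number of points,
then they contain a nontrivial pair that agrees at these points up to given weights. -/
theorem exists_weighted_agreement {α : Type*} [Finite α] (U V : Submodule ℝ (α → ℝ)) {d : ℕ}
    (y : Fin d → α) (w : Fin d → ℝ) (hd : d < Module.finrank ℝ U + Module.finrank ℝ V) :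
    ∃ u ∈ U, ∃ v ∈ V, ¬(u = 0 ∧ v = 0) ∧ ∀ i, w i * u (y i) = v (y i) := by
  let L : (U × V) →ₗ[ℝ] (Fin d → ℝ) :=
    LinearMap.pi fun i => (w i • (LinearMap.proj (y i)).comp U.subtype).coprod
      (-(LinearMap.proj (y i)).comp V.subtype)
  have hker : LinearMap.ker L ≠ ⊥ := by
    apply LinearMap.ker_ne_bot_of_finrank_lt
    rwa [Module.finrank_prod, Module.finrank_fin_fun]
  obtain ⟨⟨⟨u, hu⟩, ⟨v, hv⟩⟩, hmem, hne⟩ := Submodule.exists_mem_ne_zero_of_ne_bot hker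
  refine ⟨u, hu, v, hv, by simpa using hne, fun i => ?_⟩
  have := congrFun (LinearMap.mem_ker.mp hmem) i
  simpa [L, ← sub_eq_add_neg, sub_eq_zero] using this

open MvPolynomial in
/-- Under the Hilbert function inequality, a nonnegative polynomial has a nonzero multiplier
that is a single square and turns it into a single square. -/
theorem exists_square_multiplier {n : ℕ} {X : Set (Fin n → ℝ)} (hX : X.Finite)
    {s k : ℕ} {p : MvPolynomial (Fin n) ℝ} (hdeg : p.totalDegree ≤ 2 * s)
    (hpos : ∀ x ∈ X, 0 ≤ eval x p)
    (hH : hilbert n X (2 * k + 2 * s) < hilbert n X (k + s) + hilbert n X k) :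
    ∃ q g : MvPolynomial (Fin n) ℝ, q.totalDegree ≤ k ∧ g.totalDegree ≤ k + s ∧
      (∃ x ∈ X, eval x q ≠ 0) ∧ ∀ x ∈ X, eval x p * eval x q ^ 2 = eval x g ^ 2 := by
  have := hX.to_subtype
  unfold hilbert at hH
  set U : ℕ → Submodule ℝ (X → ℝ) := fun t => Submodule.span ℝ
    {f : X → ℝ | ∃ p : MvPolynomial (Fin n) ℝ, p.totalDegree ≤ t ∧
      ∀ x : X, f x = MvPolynomial.eval (x : Fin n → ℝ) p} with hU
  obtain ⟨d, y, hd, hy⟩ := exists_determining_points (U (2 * k + 2 * s))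
  have vanish : ∀ r : MvPolynomial (Fin n) ℝ, r.totalDegree ≤ 2 * k + 2 * s →
      (∀ i, eval (y i : Fin n → ℝ) r = 0) → ∀ x ∈ X, eval x r = 0 := fun r hr h0 x hx =>
    congrFun (hy (fun x => eval (x : Fin n → ℝ) r)
      (Submodule.subset_span ⟨r, hr, fun _ => rfl⟩) h0) ⟨x, hx⟩
  obtain ⟨u, hu, v, hv, hne, huv⟩ := exists_weighted_agreement (U k) (U (k + s)) y
    (fun i => √(eval (y i : Fin n → ℝ) p)) (hd.trans_lt (hH.trans_eq (add_comm _ _)))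
  obtain ⟨q, hq, huq⟩ := exists_poly_of_mem_span hu
  obtain ⟨g, hg, hvg⟩ := exists_poly_of_mem_span hv
  have heq : ∀ i, √(eval (y i : Fin n → ℝ) p) * eval (y i : Fin n → ℝ) q
      = eval (y i : Fin n → ℝ) g := fun i => by rw [← huq, ← hvg, huv]
  refine ⟨q, g, hq, hg, ?_, fun x hx => ?_⟩
  · by_contra! hq0
    have hg0 : ∀ x ∈ X, eval x g = 0 := vanish g (hg.trans (by omega)) fun i => by rw [← heq i, hq0 _ (y i).2, mul_zero]
    exact hne ⟨funext fun x => by rw [huq, hq0 x x.2, Pi.zero_apply],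
      funext fun x => by rw [hvg, hg0 x x.2, Pi.zero_apply]⟩
  · have hr : (p * q ^ 2 - g ^ 2).totalDegree ≤ 2 * k + 2 * s := by
      have h1 := totalDegree_sub (p * q ^ 2) (g ^ 2)
      have h2 := totalDegree_mul p (q ^ 2)
      have h3 := totalDegree_pow q 2
      have h4 := totalDegree_pow g 2
      omega
    have := vanish _ hr (fun i => by
      simp only [map_sub, map_mul, map_pow]
      rw [← heq i, mul_pow, Real.sq_sqrt (hpos _ (y i).2), sub_self]) x hx
    simpa [sub_eq_zero] using this

theorem stmt0 (n : ℕ) (X : Set (Fin n → ℝ)) (hX : X.Finite)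
    (s k : ℕ) (p : MvPolynomial (Fin n) ℝ) (hdeg : p.totalDegree ≤ 2 * s)
    (hpos : ∀ x ∈ X, 0 ≤ MvPolynomial.eval x p)
    (hH : hilbert n X (2 * k + 2 * s) < hilbert n X (k + s) + hilbert n X k) :
    ∃ h : (Fin n → ℝ) → ℝ, IsSosOn n X k h ∧ (∃ x ∈ X, h x ≠ 0) ∧
      IsSosOn n X (k + s) (fun x => MvPolynomial.eval x p * h x) := by
  obtain ⟨q, g, hq, hg, ⟨x, hx, hne⟩, heq⟩ := exists_square_multiplier hX hdeg hpos hH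
  exact ⟨fun x => MvPolynomial.eval x q ^ 2, ⟨1, fun _ => q, fun _ => hq, fun x _ => by simp⟩,
    ⟨x, hx, pow_ne_zero 2 hne⟩, ⟨1, fun _ => g, fun _ => hg, fun x hx => by simp [heq x hx]⟩⟩
end

section
/- Let n ≥ 1 and k = ⌊n/2⌋. There exists a polynomial p ∈ ℝ[x_1,…,x_n] of total degree 4 with p(x) ≥ 0 for all x ∈ ℝ^n such that for all polynomials g_1,…,g_m of total degree at most k−2, not all zero, and all polynomials h_1,…,h_l of total degree at most k, the polynomial identity p·(g_1² + … + g_m²) = h_1² + … + h_l² fails; that is, p is not k-rsos in ℝ[x_1,…,x_n]. -/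
open Finset

/-- The pseudo-moment of `∏ i ∈ A, x i * ∏ i ∈ B, (1 - x i)` for disjoint sets `A`, `B` of sizes
`a`, `b` under the symmetric functional on the `n`-cube concentrated on `∑ i, x i = τ`. -/
noncomputable def pseudoMoment (n : ℕ) (τ : ℝ) (a b : ℕ) : ℝ :=
  (∏ i ∈ range a, (τ - i)) * (∏ i ∈ range b, (n - τ - i)) / ∏ i ∈ range (a + b), ((n : ℝ) - i)

lemma prod_range_natCast_sub_pos {n m : ℕ} (h : m ≤ n) : 0 < ∏ i ∈ range m, ((n : ℝ) - i) := by
  refine prod_pos fun i hi => ?_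
  have : (i : ℝ) < n := by exact_mod_cast (mem_range.1 hi).trans_le h
  linarith

lemma pseudoMoment_split {n : ℕ} (τ : ℝ) {a b : ℕ} (h : a + b < n) :
    pseudoMoment n τ a b = pseudoMoment n τ (a + 1) b + pseudoMoment n τ a (b + 1) := by
  have h0 := (prod_range_natCast_sub_pos h.le).ne'
  have h1 := (prod_range_natCast_sub_pos (Nat.succ_le_of_lt h)).ne'
  rw [Nat.succ_eq_add_one] at h1
  unfold pseudoMoment
  rw [show a + 1 + b = a + b + 1 by ring, show a + (b + 1) = a + b + 1 by ring, ← add_div,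
    div_eq_div_iff h0 h1]
  simp only [prod_range_succ]
  push_cast
  ring

lemma pseudoMoment_zero_succ {n : ℕ} (τ : ℝ) {a : ℕ} (h : a < n) :
    (n - a) * pseudoMoment n τ (a + 1) 0 = (τ - a) * pseudoMoment n τ a 0 := by
  have h0 := (prod_range_natCast_sub_pos h.le).ne'
  have h1 := (prod_range_natCast_sub_pos (Nat.succ_le_of_lt h)).ne'
  rw [Nat.succ_eq_add_one] at h1
  unfold pseudoMoment
  rw [← mul_div_assoc, ← mul_div_assoc, add_zero, add_zero, div_eq_div_iff h1 h0]
  simp only [prod_range_succ]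
  ring

lemma pseudoMoment_nonneg {n : ℕ} {τ : ℝ} {a b : ℕ} (h : a + b ≤ n) (ha : (a : ℝ) - 1 ≤ τ)
    (hb : (b : ℝ) - 1 ≤ n - τ) : 0 ≤ pseudoMoment n τ a b := by
  refine div_nonneg (mul_nonneg (prod_nonneg fun i hi => ?_) (prod_nonneg fun i hi => ?_))
    (prod_range_natCast_sub_pos h).le
  · have : (i : ℝ) + 1 ≤ a := by exact_mod_cast mem_range.1 hi
    linarith
  · have : (i : ℝ) + 1 ≤ b := by exact_mod_cast mem_range.1 hi
    linarith

lemma pseudoMoment_eq_sum_powerset {α : Type*} [DecidableEq α] {n : ℕ} (τ : ℝ) (I : Finset α) :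
    ∀ {a b : ℕ}, a + b + I.card ≤ n →
      pseudoMoment n τ a b =
        ∑ U ∈ I.powerset, pseudoMoment n τ (a + I.card - U.card) (b + U.card) := by
  induction I using Finset.induction_on with
  | empty => intro a b _; simp
  | insert x I hx ih =>
    intro a b h
    rw [card_insert_of_notMem hx] at h ⊢
    rw [sum_powerset_insert hx, pseudoMoment_split τ (by omega), ih (by omega), ih (by omega)]
    congr 1
    · refine sum_congr rfl fun U _ => ?_
      congr 1; omega
    · refine sum_congr rfl fun U hU => ?_
      rw [card_insert_of_notMem fun h' => hx (mem_powerset.1 hU h')]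
      congr 1 <;> omega

/-- The indicator of the sets containing `S`: the squarefree monomial of `S` on the cube. -/
def cubeMonomial {n : ℕ} (S : Finset (Fin n)) : Finset (Fin n) → ℝ :=
  fun T => if S ⊆ T then 1 else 0

lemma cubeMonomial_mul {n : ℕ} (S T : Finset (Fin n)) :
    cubeMonomial S * cubeMonomial T = cubeMonomial (S ∪ T) := by
  funext U
  simp only [cubeMonomial, Pi.mul_apply, union_subset_iff]
  split_ifs <;> simp_all

/-- The symmetric pseudo-expectation on functions on the `n`-cube concentrated on
`∑ i, x i = τ`. -/
noncomputable def pseudoExp (n : ℕ) (τ : ℝ) : (Finset (Fin n) → ℝ) →ₗ[ℝ] ℝ :=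
  ∑ T : Finset (Fin n), pseudoMoment n τ T.card Tᶜ.card • LinearMap.proj T

lemma pseudoExp_apply (n : ℕ) (τ : ℝ) (F : Finset (Fin n) → ℝ) :
    pseudoExp n τ F = ∑ T, pseudoMoment n τ T.card Tᶜ.card * F T := by
  simp [pseudoExp]

lemma pseudoExp_cubeMonomial {n : ℕ} (τ : ℝ) (S : Finset (Fin n)) :
    pseudoExp n τ (cubeMonomial S) = pseudoMoment n τ S.card 0 := by
  have hc : S.card + Sᶜ.card = n := by simp
  rw [pseudoExp_apply, pseudoMoment_eq_sum_powerset τ Sᶜ (by omega), hc]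
  simp only [cubeMonomial, mul_ite, mul_one, mul_zero]
  rw [← sum_filter]
  refine sum_nbij' (fun T => Tᶜ) (fun T => Tᶜ) ?_ ?_ ?_ ?_ ?_
  · intro T hT; simpa using hT
  · intro T hT
    have := compl_subset_compl.2 (mem_powerset.1 hT)
    simpa using this
  · simp
  · simp
  · intro T _
    have : T.card + Tᶜ.card = n := by simp
    congr 1 <;> omega

/-- Functions on the `n`-cube of degree at most `d`. -/
def cubeDegreeLE (n d : ℕ) : Submodule ℝ (Finset (Fin n) → ℝ) :=
  Submodule.span ℝ (cubeMonomial '' {S | S.card ≤ d})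

lemma cubeMonomial_mem {n d : ℕ} {S : Finset (Fin n)} (h : S.card ≤ d) :
    cubeMonomial S ∈ cubeDegreeLE n d :=
  Submodule.subset_span ⟨S, h, rfl⟩

lemma cubeDegreeLE_mono {n d e : ℕ} (h : d ≤ e) : cubeDegreeLE n d ≤ cubeDegreeLE n e :=
  Submodule.span_mono (Set.image_mono fun _ hS => le_trans hS h)

lemma cubeDegreeLE_mul {n d e : ℕ} {F G : Finset (Fin n) → ℝ} (hF : F ∈ cubeDegreeLE n d)
    (hG : G ∈ cubeDegreeLE n e) : F * G ∈ cubeDegreeLE n (d + e) := by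
  have := Submodule.mul_mem_mul hF hG
  rw [cubeDegreeLE, cubeDegreeLE, Submodule.span_mul_span] at this
  refine Submodule.span_le.2 ?_ this
  rintro _ ⟨_, ⟨S, hS, rfl⟩, _, ⟨T, hT, rfl⟩, rfl⟩
  simp only [cubeMonomial_mul]
  exact cubeMonomial_mem ((card_union_le S T).trans (add_le_add hS hT))

lemma linearMap_eq_zero_of_cubeMonomial {n d : ℕ} (φ : (Finset (Fin n) → ℝ) →ₗ[ℝ] ℝ)
    (h : ∀ S : Finset (Fin n), S.card ≤ d → φ (cubeMonomial S) = 0) {F : Finset (Fin n) → ℝ}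
    (hF : F ∈ cubeDegreeLE n d) : φ F = 0 := by
  have : cubeDegreeLE n d ≤ LinearMap.ker φ := by
    refine Submodule.span_le.2 ?_
    rintro _ ⟨S, hS, rfl⟩
    exact h S hS
  exact this hF

lemma card_mul_cubeMonomial {n : ℕ} (S : Finset (Fin n)) :
    (fun T : Finset (Fin n) => (T.card : ℝ)) * cubeMonomial S =
      (S.card : ℝ) • cubeMonomial S + ∑ i ∈ Sᶜ, cubeMonomial (insert i S) := by
  funext T
  simp only [Pi.mul_apply, Pi.add_apply, Pi.smul_apply, Finset.sum_apply, cubeMonomial,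
    insert_subset_iff, smul_eq_mul]
  by_cases h : S ⊆ T
  · simp only [h, and_true, if_true, mul_one, sum_boole]
    rw [show (Sᶜ.filter fun i => i ∈ T) = T \ S by ext; simp [and_comm], card_sdiff_of_subset h,
      Nat.cast_sub (card_le_card h)]
    ring
  · simp [h]

lemma pseudoExp_card_mul {n : ℕ} (τ : ℝ) {d : ℕ} (hd : d < n) {F : Finset (Fin n) → ℝ}
    (hF : F ∈ cubeDegreeLE n d) :
    pseudoExp n τ ((fun T : Finset (Fin n) => (T.card : ℝ)) * F) = τ * pseudoExp n τ F := by
  rw [← sub_eq_zero]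
  refine linearMap_eq_zero_of_cubeMonomial
    (pseudoExp n τ ∘ₗ LinearMap.mulLeft ℝ (fun T : Finset (Fin n) => (T.card : ℝ)) -
      τ • pseudoExp n τ) (fun S hS => ?_) hF
  simp only [LinearMap.sub_apply, LinearMap.comp_apply, LinearMap.mulLeft_apply,
    LinearMap.smul_apply, card_mul_cubeMonomial, map_add, map_smul, map_sum,
    pseudoExp_cubeMonomial, smul_eq_mul]
  rw [sum_congr rfl fun i hi => by rw [card_insert_of_notMem (mem_compl.1 hi)], sum_const,
    card_compl, Fintype.card_fin, nsmul_eq_mul, Nat.cast_sub (hS.trans hd.le),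
    pseudoMoment_zero_succ τ (hS.trans_lt hd)]
  ring

lemma pseudoExp_harmonic_mul {n d : ℕ} (τ : ℝ) (hd : 2 * d ≤ n) {H : Finset (Fin n) → ℝ}
    (hs : ∀ S, S.card ≠ d → H S = 0)
    (hh : ∀ U : Finset (Fin n), U.card < d → ∑ S, (if U ⊆ S then H S else 0) = 0)
    {T : Finset (Fin n)} (hT : T.card ≤ d) :
    pseudoExp n τ ((∑ S, H S • cubeMonomial S) * cubeMonomial T) =
      if T.card = d then pseudoMoment n τ d d * H T else 0 := by
  have key : ∀ S, H S * pseudoMoment n τ (S ∪ T).card 0 =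
      ∑ U ∈ T.powerset, pseudoMoment n τ (d + T.card - U.card) U.card *
        (if U ⊆ S then H S else 0) := by
    intro S
    by_cases hS : S.card = d
    · have h1 := card_union_add_card_inter S T
      rw [pseudoMoment_eq_sum_powerset τ (S ∩ T) (by omega), mul_sum]
      simp only [mul_ite, mul_zero]
      rw [← sum_filter]
      refine sum_congr ?_ fun U _ => ?_
      · ext U
        simp only [mem_powerset, mem_filter, subset_inter_iff, and_comm]
      · rw [zero_add, mul_comm]
        congr 2; omega
    · simp [hs S hS]
  simp only [sum_mul, smul_mul_assoc, cubeMonomial_mul, map_sum, map_smul,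
    pseudoExp_cubeMonomial, smul_eq_mul, key]
  rw [sum_comm]
  simp only [← mul_sum]
  split_ifs with h
  · rw [sum_eq_single T]
    · rw [sum_eq_single T]
      · simp [h]
      · intro S _ hST
        split_ifs with hsub
        · exact hs S fun hS => hST (eq_of_subset_of_card_le hsub (by omega)).symm
        · rfl
      · simp
    · intro U hU hUT
      rw [hh U, mul_zero]
      have := card_lt_card ((mem_powerset.1 hU).ssubset_of_ne hUT)
      omega
    · simp
  · refine sum_eq_zero fun U hU => ?_
    rw [hh U, mul_zero]
    have := card_le_card (mem_powerset.1 hU)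
    omega

lemma harmonic_of_codim_one {n d : ℕ} {H : Finset (Fin n) → ℝ}
    (hs : ∀ S, S.card ≠ d + 1 → H S = 0)
    (hh : ∀ R : Finset (Fin n), R.card = d → ∑ i ∈ Rᶜ, H (insert i R) = 0)
    (U : Finset (Fin n)) (hU : U.card < d + 1) : ∑ S, (if U ⊆ S then H S else 0) = 0 := by
  induction hm : d - U.card generalizing U with
  | zero =>
    have hUd : U.card = d := by omega
    rw [← sum_filter, ← hh U hUd]
    symm
    refine sum_of_injOn (fun i => insert i U) ?_ ?_ ?_ (fun _ _ => rfl)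
    · intro i hi j hj hij
      simp only [coe_compl, Set.mem_compl_iff, mem_coe] at hi hj
      have : i ∈ insert j U := by rw [← show insert i U = insert j U from hij]; simp
      simpa [hi] using this
    · intro i _; simp
    · intro S hS hS'
      by_contra hne
      have hcard : S.card = d + 1 := by by_contra h; exact hne (hs S h)
      have hsub : U ⊆ S := by simpa using hS
      have h1 : (S \ U).card = 1 := by rw [card_sdiff_of_subset hsub]; omega
      obtain ⟨i, hi⟩ := card_eq_one.1 h1
      refine hS' ⟨i, ?_, ?_⟩
      · have : i ∈ S \ U := by simp [hi]
        simpa using (mem_sdiff.1 this).2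
      · change insert i U = S
        rw [insert_eq, ← hi, sdiff_union_of_subset hsub]
  | succ m ih =>
    have h1 : ∑ i ∈ Uᶜ, ∑ S, (if insert i U ⊆ S then H S else 0) = 0 := by
      refine sum_eq_zero fun i hi => ?_
      have := card_insert_of_notMem (mem_compl.1 hi)
      exact ih _ (by omega) (by omega)
    rw [sum_comm] at h1
    have h2 : ∀ S, ∑ i ∈ Uᶜ, (if insert i U ⊆ S then H S else 0) =
        ((d : ℝ) + 1 - U.card) * (if U ⊆ S then H S else 0) := by
      intro S
      by_cases h : U ⊆ S
      · simp only [insert_subset_iff, h, and_true, if_true]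
        rw [← sum_filter, sum_const,
          show (Uᶜ.filter fun i => i ∈ S) = S \ U by ext; simp [and_comm], nsmul_eq_mul]
        by_cases hc : S.card = d + 1
        · rw [card_sdiff_of_subset h, Nat.cast_sub (card_le_card h), hc]; push_cast; ring
        · simp [hs S hc]
      · simp [insert_subset_iff, h]
    simp only [h2, ← mul_sum] at h1
    refine (mul_eq_zero.1 h1).resolve_left ?_
    have : (U.card : ℝ) < d + 1 := by exact_mod_cast hU
    linarith

lemma exists_harmonic_decomposition {n d : ℕ} (τ : ℝ) (hd : 2 * (d + 1) ≤ n)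
    {F : Finset (Fin n) → ℝ} (hF : F ∈ cubeDegreeLE n (d + 1)) :
    ∃ H : Finset (Fin n) → ℝ, (∀ S, S.card ≠ d + 1 → H S = 0) ∧
      (∀ R : Finset (Fin n), R.card = d → ∑ i ∈ Rᶜ, H (insert i R) = 0) ∧
      ∃ E ∈ cubeDegreeLE n d, ∀ G ∈ cubeDegreeLE n (d + 1),
        pseudoExp n τ (F * G) = pseudoExp n τ ((∑ S, H S • cubeMonomial S + E) * G) := by
  induction hF using Submodule.span_induction with
  | zero => exact ⟨0, by simp, by simp, 0, zero_mem _, by simp⟩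
  | add F F' _ _ ih ih' =>
    obtain ⟨H, h1, h2, E, hE, h3⟩ := ih
    obtain ⟨H', h1', h2', E', hE', h3'⟩ := ih'
    refine ⟨H + H', fun S hS => by simp [h1 S hS, h1' S hS],
      fun R hR => by simp [sum_add_distrib, h2 R hR, h2' R hR], E + E', add_mem hE hE',
      fun G hG => ?_⟩
    rw [add_mul, map_add, h3 G hG, h3' G hG, ← map_add, ← add_mul]
    simp only [Pi.add_apply, add_smul, sum_add_distrib]
    congr 2
    abel
  | smul c F _ ih =>
    obtain ⟨H, h1, h2, E, hE, h3⟩ := ih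
    refine ⟨c • H, fun S hS => by simp [h1 S hS],
      fun R hR => by simp [← mul_sum, h2 R hR], c • E, Submodule.smul_mem _ _ hE,
      fun G hG => ?_⟩
    rw [smul_mul_assoc, map_smul, h3 G hG, ← map_smul, ← smul_mul_assoc]
    simp only [Pi.smul_apply, smul_assoc, smul_add, smul_sum]
  | mem F hF =>
    obtain ⟨S, hS, rfl⟩ := hF
    rcases (show S.card ≤ d + 1 from hS).lt_or_eq with hlt | heq
    · exact ⟨0, by simp, by simp, cubeMonomial S, cubeMonomial_mem (by omega), by simp⟩
    let u : Finset (Fin n) → EuclideanSpace ℝ (Finset (Fin n)) :=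
      fun R => ∑ i ∈ Rᶜ, EuclideanSpace.single (insert i R) (1 : ℝ)
    let K : Submodule ℝ (EuclideanSpace ℝ (Finset (Fin n))) :=
      Submodule.span ℝ (u '' {R | R.card = d})
    obtain ⟨y, hy, z, hz, hyz⟩ := K.exists_add_mem_mem_orthogonal (EuclideanSpace.single S (1 : ℝ))
    have hzy : ∀ T, z T = (if T = S then 1 else 0) - y T := by
      intro T
      have := congrArg (fun v => v.ofLp T) hyz
      simp at this
      linarith
    have hy' : (∀ T, T.card ≠ d + 1 → y T = 0) ∧ ∃ E ∈ cubeDegreeLE n d,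
        ∀ G ∈ cubeDegreeLE n (d + 1),
          pseudoExp n τ ((∑ T, y T • cubeMonomial T) * G) = pseudoExp n τ (E * G) := by
      clear hyz hzy
      induction hy using Submodule.span_induction with
      | zero => exact ⟨by simp, 0, zero_mem _, by simp⟩
      | add v v' _ _ ih ih' =>
        obtain ⟨h1, E, hE, h2⟩ := ih
        obtain ⟨h1', E', hE', h2'⟩ := ih'
        refine ⟨fun T hT => by simp [h1 T hT, h1' T hT], E + E', add_mem hE hE', fun G hG => ?_⟩
        simp only [PiLp.add_apply, add_smul, sum_add_distrib, add_mul, map_add, h2 G hG,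
          h2' G hG]
      | smul c v _ ih =>
        obtain ⟨h1, E, hE, h2⟩ := ih
        refine ⟨fun T hT => by simp [h1 T hT], c • E, Submodule.smul_mem _ _ hE, fun G hG => ?_⟩
        simp only [PiLp.smul_apply, smul_assoc, ← smul_sum, smul_mul_assoc, map_smul, h2 G hG]
      | mem v hv =>
        obtain ⟨R, hR, rfl⟩ := hv
        have hR : R.card = d := hR
        have hu : ∀ T, u R T = ∑ i ∈ Rᶜ, if T = insert i R then 1 else 0 := by
          intro T
          simp [u, Pi.single_apply]
        refine ⟨fun T hT => ?_, (τ - d) • cubeMonomial R,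
          Submodule.smul_mem _ _ (cubeMonomial_mem hR.le), fun G hG => ?_⟩
        · rw [hu]
          refine sum_eq_zero fun i hi => if_neg ?_
          rintro rfl
          exact hT (by rw [card_insert_of_notMem (mem_compl.1 hi), hR])
        · have h1 : ∑ T, u R T • cubeMonomial T =
              (fun T : Finset (Fin n) => (T.card : ℝ)) * cubeMonomial R -
                (d : ℝ) • cubeMonomial R := by
            rw [card_mul_cubeMonomial, hR, add_sub_cancel_left]
            simp only [hu, sum_smul, ite_smul, one_smul, zero_smul]
            rw [sum_comm]
            simp
          have h2 := pseudoExp_card_mul τ (show d + (d + 1) < n by omega)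
            (cubeDegreeLE_mul (cubeMonomial_mem hR.le) hG)
          rw [h1, sub_mul, map_sub, mul_assoc, h2]
          simp only [smul_mul_assoc, map_smul, smul_eq_mul]
          ring
    obtain ⟨h1, E, hE, h2⟩ := hy'
    refine ⟨z.ofLp, fun T hT => ?_, fun R hR => ?_, E, hE, fun G hG => ?_⟩
    · rw [hzy, h1 T hT, if_neg, sub_zero]
      rintro rfl
      exact hT heq
    · have := (Submodule.mem_orthogonal K z).1 hz (u R) (Submodule.subset_span ⟨R, hR, rfl⟩)
      simpa [u, sum_inner, EuclideanSpace.inner_single_left] using this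
    · rw [add_mul, map_add, ← h2 G hG, ← map_add, ← add_mul, ← sum_add_distrib]
      congr 2
      simp only [← add_smul, hzy, sub_add_cancel, ite_smul, one_smul, zero_smul]
      simp

/-- Positivity of the symmetric pseudo-expectation on squares of low degree. -/
theorem pseudoExp_mul_self_nonneg {n d : ℕ} (τ : ℝ) (hd : 2 * d ≤ n)
    (h0 : ∀ j ≤ d, 0 ≤ pseudoMoment n τ j j) {F : Finset (Fin n) → ℝ}
    (hF : F ∈ cubeDegreeLE n d) : 0 ≤ pseudoExp n τ (F * F) := by
  induction d generalizing F with
  | zero =>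
    obtain ⟨c, rfl⟩ : ∃ c : ℝ, F = c • cubeMonomial ∅ := by
      induction hF using Submodule.span_induction with
      | mem F hF =>
        obtain ⟨S, hS, rfl⟩ := hF
        exact ⟨1, by simp [card_eq_zero.1 (Nat.le_zero.1 hS)]⟩
      | zero => exact ⟨0, by simp⟩
      | add F G _ _ ih ih' =>
        obtain ⟨a, rfl⟩ := ih
        obtain ⟨b, rfl⟩ := ih'
        exact ⟨a + b, by rw [add_smul]⟩
      | smul a F _ ih =>
        obtain ⟨b, rfl⟩ := ih
        exact ⟨a * b, by rw [mul_smul]⟩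
    have := h0 0 le_rfl
    rw [smul_mul_smul_comm, cubeMonomial_mul, map_smul, pseudoExp_cubeMonomial, smul_eq_mul]
    exact mul_nonneg (mul_self_nonneg c) (by simpa using this)
  | succ d ih =>
    obtain ⟨H, hs, hh, E, hE, key⟩ := exists_harmonic_decomposition τ hd hF
    have hh' := harmonic_of_codim_one hs hh
    set P := ∑ S, H S • cubeMonomial S with hP
    have hPmem : P ∈ cubeDegreeLE n (d + 1) := by
      refine Submodule.sum_mem _ fun S _ => ?_
      by_cases hS : S.card = d + 1
      · exact Submodule.smul_mem _ _ (cubeMonomial_mem hS.le)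
      · simp [hs S hS]
    have hPE : pseudoExp n τ (P * E) = 0 := by
      refine linearMap_eq_zero_of_cubeMonomial (pseudoExp n τ ∘ₗ LinearMap.mulLeft ℝ P)
        (fun T hT => ?_) hE
      rw [LinearMap.comp_apply, LinearMap.mulLeft_apply, hP,
        pseudoExp_harmonic_mul τ hd hs hh' (by omega), if_neg (by omega)]
    have hPP : 0 ≤ pseudoExp n τ (P * P) := by
      have : P * P = ∑ T, H T • (P * cubeMonomial T) := by
        conv_lhs => rw [hP, mul_sum]
        simp only [mul_smul_comm, ← hP]
      rw [this, map_sum]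
      refine sum_nonneg fun T _ => ?_
      by_cases hT : T.card = d + 1
      · rw [map_smul, hP, pseudoExp_harmonic_mul τ hd hs hh' hT.le, if_pos hT, smul_eq_mul,
          mul_left_comm]
        exact mul_nonneg (h0 _ le_rfl) (mul_self_nonneg _)
      · simp [hs T hT]
    have hmem : P + E ∈ cubeDegreeLE n (d + 1) :=
      add_mem hPmem (cubeDegreeLE_mono d.le_succ hE)
    rw [key F hF, mul_comm, key _ hmem,
      show (P + E) * (P + E) = P * P + (P * E + P * E) + E * E by ring, map_add, map_add,
      map_add, hPE]
    have := ih (by omega) (fun j hj => h0 j (by omega)) hE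
    linarith

namespace MvPolynomial

lemma natDegree_prod_linear_pow_le {σ : Type*} (u v : σ → ℝ) (α : σ → ℕ) (s : Finset σ) :
    (∏ i ∈ s, (Polynomial.C (u i) * Polynomial.X + Polynomial.C (v i)) ^ α i).natDegree ≤
      ∑ i ∈ s, α i := by
  refine (Polynomial.natDegree_prod_le _ _).trans (sum_le_sum fun i _ => ?_)
  refine Polynomial.natDegree_pow_le.trans ?_
  simpa using Nat.mul_le_mul_left (α i) (Polynomial.natDegree_linear_le (a := u i) (b := v i))

lemma coeff_prod_linear_pow {σ : Type*} (u v : σ → ℝ) (α : σ → ℕ) (s : Finset σ) :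
    (∏ i ∈ s, (Polynomial.C (u i) * Polynomial.X + Polynomial.C (v i)) ^ α i).coeff
      (∑ i ∈ s, α i) = ∏ i ∈ s, u i ^ α i := by
  classical
  induction s using Finset.induction_on with
  | empty => simp
  | insert a s ha ih =>
    rw [prod_insert ha, sum_insert ha, prod_insert ha, Polynomial.coeff_mul_add_eq_of_natDegree_le
      _ (natDegree_prod_linear_pow_le u v α s), ih]
    · have := Polynomial.coeff_pow_of_natDegree_le (m := α a)
        (Polynomial.natDegree_linear_le (a := u a) (b := v a))
      rw [mul_one] at this
      rw [this]
      simp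
    · simpa using natDegree_prod_linear_pow_le u v α {a}

lemma coeff_aeval_linear {σ : Type*} (u v : σ → ℝ) (G : MvPolynomial σ ℝ) :
    (aeval (fun i => Polynomial.C (u i) * Polynomial.X + Polynomial.C (v i)) G).coeff
      G.totalDegree = eval u (homogeneousComponent G.totalDegree G) := by
  rw [aeval_def, eval₂_eq, homogeneousComponent_apply, map_sum, Polynomial.finsetSum_coeff,
    sum_filter]
  refine sum_congr rfl fun α hα => ?_
  rw [Polynomial.algebraMap_eq, Polynomial.coeff_C_mul]
  split_ifs with h
  · rw [eval_monomial, ← h, Finsupp.prod, Finsupp.degree_apply, coeff_prod_linear_pow]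
  · rw [Polynomial.coeff_eq_zero_of_natDegree_lt, mul_zero]
    refine (natDegree_prod_linear_pow_le u v α α.support).trans_lt ?_
    exact lt_of_le_of_ne (le_totalDegree hα) h

lemma homogeneousComponent_totalDegree_ne_zero {σ : Type*} {G : MvPolynomial σ ℝ} (hG : G ≠ 0) :
    homogeneousComponent G.totalDegree G ≠ 0 := by
  obtain ⟨α, hα, h⟩ := exists_mem_eq_sup G.support (support_nonempty.2 hG)
    (fun s => s.sum fun _ e => e)
  intro h0
  have h1 := congrArg (coeff α) h0
  rw [coeff_homogeneousComponent, if_pos, coeff_zero] at h1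
  · exact mem_support_iff.1 hα h1
  · exact h.symm

/-- A nontrivial weighted average of translates of a nonzero polynomial is nonzero. -/
lemma exists_sum_eval_add_ne_zero {σ ι : Type*} [Fintype σ] [Fintype ι] {G : MvPolynomial σ ℝ}
    (hG : G ≠ 0) (w : ι → ℝ) (v : ι → σ → ℝ) (hw : ∑ t, w t ≠ 0) {s : Set ℝ} (hs : s.Infinite) :
    ∃ c : σ → ℝ, (∀ i, c i ∈ s) ∧ ∑ t, w t * eval (v t + c) G ≠ 0 := by
  by_contra! hcon
  let Q : MvPolynomial σ ℝ := ∑ t, C (w t) * aeval (fun i => C (v t i) + X i) G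
  have hQe : ∀ c, eval c Q = ∑ t, w t * eval (v t + c) G := by
    intro c
    simp only [Q, map_sum, map_mul, eval_C]
    refine sum_congr rfl fun t _ => ?_
    congr 1
    rw [aeval_def, ← coe_eval₂Hom]
    change ((eval c).comp (eval₂Hom _ _)) G = _
    refine congrFun (congrArg DFunLike.coe ?_) G
    ext <;> simp
  have hQ : Q = 0 := by
    refine funext_set (fun _ => s) (fun _ => hs) fun c hc => ?_
    rw [hQe, hcon c (fun i => hc i (Set.mem_univ i)), map_zero]
  refine homogeneousComponent_totalDegree_ne_zero hG (MvPolynomial.funext fun u => ?_)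
  let P : Polynomial ℝ := ∑ t, Polynomial.C (w t) *
    aeval (fun i => Polynomial.C (u i) * Polynomial.X + Polynomial.C (v t i)) G
  have hP : P = 0 := by
    refine Polynomial.funext fun r => ?_
    have h := hQe (fun i => u i * r)
    rw [hQ, map_zero] at h
    rw [Polynomial.eval_zero, h]
    simp only [P, Polynomial.eval_finsetSum, Polynomial.eval_mul, Polynomial.eval_C]
    refine sum_congr rfl fun t _ => ?_
    congr 1
    rw [aeval_def, ← coe_eval₂Hom]
    change ((Polynomial.evalRingHom r).comp (eval₂Hom _ _)) G = _
    refine congrFun (congrArg DFunLike.coe ?_) G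
    ext i
    · simp
    · simp [add_comm]
  have h := congrArg (fun p => Polynomial.coeff p G.totalDegree) hP
  simp only [P, Polynomial.finsetSum_coeff, Polynomial.coeff_C_mul, coeff_aeval_linear,
    ← sum_mul, Polynomial.coeff_zero] at h
  rw [map_zero]
  exact (mul_eq_zero.1 h).resolve_left hw

end MvPolynomial

/-- The vertex of the cube `∏ i, {c i, c i + 1}` indexed by `T`. -/
def cubePoint {n : ℕ} (c : Fin n → ℝ) (T : Finset (Fin n)) : Fin n → ℝ :=
  (fun i => if i ∈ T then 1 else 0) + c

lemma one_mem_cubeDegreeLE (n d : ℕ) : (1 : Finset (Fin n) → ℝ) ∈ cubeDegreeLE n d := by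
  have h : (1 : Finset (Fin n) → ℝ) = cubeMonomial ∅ := by ext; simp [cubeMonomial]
  exact h ▸ cubeMonomial_mem (by simp)

lemma prod_mem_cubeDegreeLE {n : ℕ} {ι : Type*} (s : Finset ι) (f : ι → Finset (Fin n) → ℝ)
    (d : ι → ℕ) (h : ∀ i ∈ s, f i ∈ cubeDegreeLE n (d i)) :
    ∏ i ∈ s, f i ∈ cubeDegreeLE n (∑ i ∈ s, d i) := by
  classical
  induction s using Finset.induction_on with
  | empty => simpa using one_mem_cubeDegreeLE n 0
  | insert a s ha ih =>
    rw [prod_insert ha, sum_insert ha]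
    exact cubeDegreeLE_mul (h a (mem_insert_self _ _))
      (ih fun i hi => h i (mem_insert_of_mem hi))

lemma eval_cubePoint_mem {n d : ℕ} (c : Fin n → ℝ) {q : MvPolynomial (Fin n) ℝ}
    (hq : q.totalDegree ≤ d) :
    (fun T => MvPolynomial.eval (cubePoint c T) q) ∈ cubeDegreeLE n d := by
  have hcoord : ∀ i, (fun T => cubePoint c T i) ∈ cubeDegreeLE n 1 := by
    intro i
    have : (fun T => cubePoint c T i) = cubeMonomial {i} + c i • (1 : Finset (Fin n) → ℝ) := by
      ext T; simp [cubePoint, cubeMonomial]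
    rw [this]
    exact add_mem (cubeMonomial_mem (by simp)) (Submodule.smul_mem _ _ (one_mem_cubeDegreeLE n 1))
  have h : (fun T => MvPolynomial.eval (cubePoint c T) q) = ∑ α ∈ q.support,
      q.coeff α • ∏ i ∈ α.support, ∏ _j ∈ range (α i), fun T => cubePoint c T i := by
    ext T
    simp [MvPolynomial.eval_eq]
  rw [h]
  refine Submodule.sum_mem _ fun α hα => Submodule.smul_mem _ _ ?_
  refine cubeDegreeLE_mono ((MvPolynomial.le_totalDegree hα).trans hq)
    (prod_mem_cubeDegreeLE _ _ _ fun i _ => ?_)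
  simpa using prod_mem_cubeDegreeLE (range (α i)) (fun _ T => cubePoint c T i) (fun _ => 1)
    fun _ _ => hcoord i

/-- A quartic, nonnegative on all of `ℝⁿ`, and negative in a suitable sense on the slice
`∑ i, x i = τ` of the cube `{0, 1}ⁿ`. -/
noncomputable def knapsackQuartic (n : ℕ) (τ : ℝ) : MvPolynomial (Fin n) ℝ :=
  (∑ i, MvPolynomial.X i - MvPolynomial.C τ) ^ 2 - MvPolynomial.C (1 / 8) +
    MvPolynomial.C (32 * (n : ℝ) ^ 2) * ∑ i, (MvPolynomial.X i ^ 2 - MvPolynomial.X i) ^ 2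

lemma eval_knapsackQuartic (n : ℕ) (τ : ℝ) (x : Fin n → ℝ) :
    MvPolynomial.eval x (knapsackQuartic n τ) =
      (∑ i, x i - τ) ^ 2 - 1 / 8 + 32 * (n : ℝ) ^ 2 * ∑ i, (x i ^ 2 - x i) ^ 2 := by
  simp [knapsackQuartic]

lemma totalDegree_knapsackQuartic {n : ℕ} (hn : 1 ≤ n) (τ : ℝ) :
    (knapsackQuartic n τ).totalDegree = 4 := by
  have hX : ∀ i : Fin n, (MvPolynomial.X i : MvPolynomial (Fin n) ℝ).totalDegree ≤ 1 :=
    fun i => (MvPolynomial.totalDegree_X i).le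
  refine le_antisymm ?_ ?_
  · refine (MvPolynomial.totalDegree_add _ _).trans (max_le ?_ ?_)
    · refine (MvPolynomial.totalDegree_sub_C_le _ _).trans
        ((MvPolynomial.totalDegree_pow _ _).trans ?_)
      have : (∑ i, MvPolynomial.X i - MvPolynomial.C τ : MvPolynomial (Fin n) ℝ).totalDegree ≤ 1 :=
        (MvPolynomial.totalDegree_sub_C_le _ _).trans
          (MvPolynomial.totalDegree_finsetSum_le fun i _ => hX i)
      omega
    · refine (MvPolynomial.totalDegree_mul _ _).trans ?_
      rw [MvPolynomial.totalDegree_C, zero_add]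
      refine MvPolynomial.totalDegree_finsetSum_le fun i _ =>
        (MvPolynomial.totalDegree_pow _ _).trans ?_
      have h1 := MvPolynomial.totalDegree_sub (MvPolynomial.X i ^ 2 : MvPolynomial (Fin n) ℝ)
        (MvPolynomial.X i)
      have h2 := MvPolynomial.totalDegree_pow (MvPolynomial.X i : MvPolynomial (Fin n) ℝ) 2
      have := hX i
      omega
  · have h := MvPolynomial.aeval_natDegree_le (knapsackQuartic n τ) le_rfl
      (fun _ => (Polynomial.X : Polynomial ℝ)) (n := 1) (fun _ => Polynomial.natDegree_X_le)
    rw [mul_one] at h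
    refine le_trans (le_of_eq ?_) h
    have h1 : MvPolynomial.aeval (fun _ => (Polynomial.X : Polynomial ℝ)) (knapsackQuartic n τ) =
        (Polynomial.C (n : ℝ) * Polynomial.X - Polynomial.C τ) ^ 2 - Polynomial.C (1 / 8) +
          Polynomial.C (32 * (n : ℝ) ^ 2 * n) * (Polynomial.X ^ 2 - Polynomial.X) ^ 2 := by
      simp only [knapsackQuartic, map_add, map_sub, map_mul, map_pow, map_sum,
        MvPolynomial.aeval_X, MvPolynomial.aeval_C, Polynomial.algebraMap_eq, sum_const,
        card_univ, Fintype.card_fin, nsmul_eq_mul]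
      simp only [← Polynomial.C_eq_natCast]
      simp
      ring
    rw [h1]
    symm
    have hn' : (n : ℝ) ≠ 0 := by positivity
    compute_degree!
    omega

lemma abs_sub_ite_le {x η : ℝ} (h : |x ^ 2 - x| ≤ η) :
    |x - (if 1 / 2 < x then 1 else 0)| ≤ 2 * η := by
  rw [show x ^ 2 - x = x * (x - 1) by ring, abs_mul] at h
  split_ifs with hx
  · have : 1 / 2 ≤ |x| := hx.le.trans (le_abs_self x)
    nlinarith [abs_nonneg (x - 1)]
  · have : 1 / 2 ≤ |x - 1| := by rw [abs_sub_comm]; exact le_trans (by linarith) (le_abs_self _)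
    rw [sub_zero]
    nlinarith [abs_nonneg x]

lemma knapsackQuartic_nonneg {n : ℕ} (hn : 1 ≤ n) (k : ℕ) (x : Fin n → ℝ) :
    0 ≤ MvPolynomial.eval x (knapsackQuartic n (k + 1 / 2)) := by
  rw [eval_knapsackQuartic]
  have hn' : (0 : ℝ) < n := by exact_mod_cast hn
  have hsq : ∀ i ∈ univ, 0 ≤ (x i ^ 2 - x i) ^ 2 := fun i _ => sq_nonneg _
  by_cases hx : ∀ i, |x i ^ 2 - x i| ≤ 1 / (16 * n)
  · obtain ⟨m, hm⟩ : ∃ m : ℕ, ∑ i, (if 1 / 2 < x i then (1 : ℝ) else 0) = m :=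
      ⟨_, sum_boole _ _⟩
    have h1 : |∑ i, x i - m| ≤ 1 / 8 := by
      rw [← hm, ← sum_sub_distrib]
      refine (abs_sum_le_sum_abs _ _).trans
        ((sum_le_sum fun i _ => abs_sub_ite_le (hx i)).trans (le_of_eq ?_))
      rw [sum_const, card_univ, Fintype.card_fin, nsmul_eq_mul]
      field_simp
      norm_num
    have h2 : 9 / 64 ≤ (∑ i, x i - (k + 1 / 2 : ℝ)) ^ 2 := by
      obtain ⟨h3, h4⟩ := abs_le.1 h1
      rcases le_or_gt m k with h | h
      · have : (m : ℝ) ≤ k := by exact_mod_cast h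
        nlinarith
      · have : (k : ℝ) + 1 ≤ m := by exact_mod_cast h
        nlinarith
    have h3 := sum_nonneg hsq
    have : 0 ≤ 32 * (n : ℝ) ^ 2 * ∑ i, (x i ^ 2 - x i) ^ 2 := by positivity
    linarith
  · push Not at hx
    obtain ⟨i, hi⟩ := hx
    have h1 : (1 / (16 * n) : ℝ) ^ 2 ≤ ∑ i, (x i ^ 2 - x i) ^ 2 := by
      refine le_trans ?_ (single_le_sum hsq (mem_univ i))
      rw [← sq_abs (x i ^ 2 - x i)]
      exact pow_le_pow_left₀ (by positivity) hi.le 2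
    have h2 : 1 / 8 ≤ 32 * (n : ℝ) ^ 2 * ∑ i, (x i ^ 2 - x i) ^ 2 := by
      refine le_trans (le_of_eq ?_) (mul_le_mul_of_nonneg_left h1 (by positivity))
      field_simp
      norm_num
    nlinarith [sq_nonneg (∑ i, x i - (k + 1 / 2 : ℝ))]

lemma pseudoExp_ite_mul_sq_nonneg {n e : ℕ} {τ : ℝ} {a b : ℝ} (ha : 0 ≤ a) (hb : 0 ≤ b)
    (hpos : ∀ F ∈ cubeDegreeLE n (e + 1), 0 ≤ pseudoExp n τ (F * F))
    {γ : Finset (Fin n) → ℝ} (hγ : γ ∈ cubeDegreeLE n e) (i : Fin n) :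
    0 ≤ pseudoExp n τ ((fun T => if i ∈ T then a else b) * (γ * γ)) := by
  have hi : cubeMonomial {i} ∈ cubeDegreeLE n 1 := cubeMonomial_mem (by simp)
  have h1 := hpos _ (add_comm 1 e ▸ cubeDegreeLE_mul hi hγ)
  have h2 := hpos _ (add_comm 1 e ▸
    cubeDegreeLE_mul (sub_mem (one_mem_cubeDegreeLE n 1) hi) hγ)
  have h3 : (fun T => if i ∈ T then a else b) * (γ * γ) =
      a • (cubeMonomial {i} * γ * (cubeMonomial {i} * γ)) +
        b • ((1 - cubeMonomial {i}) * γ * ((1 - cubeMonomial {i}) * γ)) := by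
    ext T
    by_cases h : i ∈ T <;> simp [cubeMonomial, h]
  rw [h3, map_add, map_smul, map_smul]
  exact add_nonneg (mul_nonneg ha h1) (mul_nonneg hb h2)

lemma pseudoExp_knapsackQuartic_mul_sq_le {n e : ℕ} {τ : ℝ} (hn : 1 ≤ n) (he : 2 * e + 1 < n)
    (hpos : ∀ F ∈ cubeDegreeLE n (e + 1), 0 ≤ pseudoExp n τ (F * F))
    {γ : Finset (Fin n) → ℝ} (hγ : γ ∈ cubeDegreeLE n e)
    {c : Fin n → ℝ} (hc : ∀ i, c i ∈ Set.Icc (0 : ℝ) (1 / (64 * n ^ 2))) :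
    pseudoExp n τ ((fun T => MvPolynomial.eval (cubePoint c T) (knapsackQuartic n τ)) * (γ * γ)) ≤
      -(1 / 16) * pseudoExp n τ (γ * γ) := by
  have hn1 : (1 : ℝ) ≤ n := by exact_mod_cast hn
  set N : Finset (Fin n) → ℝ := fun T => (T.card : ℝ) with hN
  set u := ∑ i, c i with hu
  set δ : ℝ := 1 / (64 * n ^ 2) with hδ
  set q := pseudoExp n τ (γ * γ) with hq
  have hq0 : 0 ≤ q := hpos γ (cubeDegreeLE_mono e.le_succ hγ)
  have hδ0 : 0 ≤ δ := by positivity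
  have hδ1 : δ ≤ 1 := by
    rw [hδ, div_le_one (by positivity)]
    nlinarith
  have hγγ := cubeDegreeLE_mul hγ hγ
  have hNmem : N ∈ cubeDegreeLE n 1 := by
    have h1 : N = ∑ i, cubeMonomial {i} := by
      ext T
      simp [cubeMonomial, hN]
    rw [h1]
    exact Submodule.sum_mem _ fun i _ => cubeMonomial_mem (by simp)
  have h1 : pseudoExp n τ (N * (γ * γ)) = τ * q :=
    pseudoExp_card_mul τ (by omega : e + e < n) hγγ
  have h2 : pseudoExp n τ (N * (N * (γ * γ))) = τ * (τ * q) := by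
    rw [← h1]
    exact pseudoExp_card_mul τ (by omega : 1 + (e + e) < n) (cubeDegreeLE_mul hNmem hγγ)
  let v : Fin n → Finset (Fin n) → ℝ :=
    fun i T => if i ∈ T then (c i ^ 2 + c i) ^ 2 else (c i ^ 2 - c i) ^ 2
  have hv : ∀ i, pseudoExp n τ (v i * (γ * γ)) ≤ 4 * δ ^ 2 * q := by
    intro i
    obtain ⟨hc0, hc1⟩ := hc i
    have hcc : c i ^ 2 ≤ c i := by nlinarith
    have h3 : (c i ^ 2 + c i) ^ 2 ≤ 4 * δ ^ 2 := by
      have : c i ^ 2 + c i ≤ 2 * δ := by linarith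
      calc (c i ^ 2 + c i) ^ 2 ≤ (2 * δ) ^ 2 := pow_le_pow_left₀ (by positivity) this 2
        _ = 4 * δ ^ 2 := by ring
    have h4 : (c i ^ 2 - c i) ^ 2 ≤ 4 * δ ^ 2 := by
      refine le_trans ?_ h3
      nlinarith [mul_nonneg (sq_nonneg (c i)) hc0]
    have h5 := pseudoExp_ite_mul_sq_nonneg (sub_nonneg.2 h3) (sub_nonneg.2 h4) hpos hγ i
    have h6 : (fun T => if i ∈ T then 4 * δ ^ 2 - (c i ^ 2 + c i) ^ 2 else
        4 * δ ^ 2 - (c i ^ 2 - c i) ^ 2) * (γ * γ) = (4 * δ ^ 2) • (γ * γ) - v i * (γ * γ) := by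
      ext T
      by_cases h : i ∈ T <;> simp [v, h] <;> ring
    rw [h6, map_sub, map_smul, smul_eq_mul] at h5
    linarith
  have hdecomp : (fun T => MvPolynomial.eval (cubePoint c T) (knapsackQuartic n τ)) * (γ * γ) =
      N * (N * (γ * γ)) + (2 * (u - τ)) • (N * (γ * γ)) +
        ((u - τ) ^ 2 - 1 / 8) • (γ * γ) + (32 * (n : ℝ) ^ 2) • ∑ i, v i * (γ * γ) := by
    ext T
    have hs : ∑ i, cubePoint c T i = N T + u := by
      simp [cubePoint, sum_add_distrib, hN, hu]
    have hvi : ∀ i, (cubePoint c T i ^ 2 - cubePoint c T i) ^ 2 = v i T := by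
      intro i
      by_cases h : i ∈ T
      · simp only [cubePoint, Pi.add_apply, h, if_true, v]; ring
      · simp only [cubePoint, Pi.add_apply, h, if_false, v]; ring
    simp only [Pi.mul_apply, Pi.add_apply, Pi.smul_apply, Finset.sum_apply, smul_eq_mul,
      eval_knapsackQuartic, hs, hvi, ← sum_mul]
    ring
  have hsum : ∑ i, pseudoExp n τ (v i * (γ * γ)) ≤ n * (4 * δ ^ 2 * q) := by
    refine (sum_le_sum fun i _ => hv i).trans (le_of_eq ?_)
    simp
  have hu0 : 0 ≤ u := sum_nonneg fun i _ => (hc i).1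
  have hu1 : u ≤ n * δ := by
    refine (sum_le_sum fun i _ => (hc i).2).trans (le_of_eq ?_)
    simp
  rw [hdecomp, map_add, map_add, map_add, map_smul, map_smul, map_smul, map_sum, h1, h2]
  simp only [smul_eq_mul, ← hq]
  have h7 : n * δ ≤ 1 / 64 := by
    rw [hδ, mul_one_div, div_le_div_iff₀ (by positivity) (by norm_num)]
    nlinarith
  have h8 : u ^ 2 ≤ 1 / 64 := by nlinarith
  have h9 : 32 * (n : ℝ) ^ 2 * (n * (4 * δ ^ 2 * q)) ≤ 1 / 32 * q := by
    have : 32 * (n : ℝ) ^ 2 * (n * (4 * δ ^ 2 * q)) = 1 / 32 * q * (1 / n) := by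
      rw [hδ]; field_simp; norm_num
    rw [this]
    exact mul_le_of_le_one_right (by positivity) (by rw [div_le_one (by positivity)]; exact hn1)
  have h10 := mul_le_mul_of_nonneg_left hsum (show 0 ≤ 32 * (n : ℝ) ^ 2 by positivity)
  have h11 : u ^ 2 * q ≤ 1 / 64 * q := mul_le_mul_of_nonneg_right h8 hq0
  nlinarith

theorem stmt2 (n k : ℕ) (hn : 1 ≤ n) (hk : k = n / 2) :
    ∃ p : MvPolynomial (Fin n) ℝ, p.totalDegree = 4 ∧
      (∀ x : Fin n → ℝ, 0 ≤ MvPolynomial.eval x p) ∧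
      ∀ (m l : ℕ) (g : Fin m → MvPolynomial (Fin n) ℝ) (h : Fin l → MvPolynomial (Fin n) ℝ),
        (∀ i, (g i).totalDegree ≤ k - 2) → (∃ i, g i ≠ 0) →
        (∀ j, (h j).totalDegree ≤ k) →
        p * ∑ i, (g i) ^ 2 ≠ ∑ j, (h j) ^ 2 := by
  refine ⟨knapsackQuartic n (k + 1 / 2), totalDegree_knapsackQuartic hn _,
    knapsackQuartic_nonneg hn k, fun m l g h hg hg0 hh heq => ?_⟩
  obtain ⟨i₀, hi₀⟩ := hg0
  rcases lt_or_ge k 2 with hk2 | hk2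
  · have hC : ∀ i, g i = MvPolynomial.C ((g i).coeff 0) := fun i =>
      MvPolynomial.totalDegree_eq_zero_iff_eq_C.1 (by have := hg i; omega)
    have hsum : ∑ i, g i ^ 2 = MvPolynomial.C (∑ i, (g i).coeff 0 ^ 2) := by
      rw [map_sum]
      exact sum_congr rfl fun i _ => by conv_lhs => rw [hC i, ← map_pow]
    have hne : ∑ i, g i ^ 2 ≠ 0 := by
      rw [hsum, Ne, MvPolynomial.C_eq_zero, sum_eq_zero_iff_of_nonneg fun i _ => sq_nonneg _]
      intro h0
      refine hi₀ ?_
      rw [hC i₀, pow_eq_zero_iff two_ne_zero |>.1 (h0 i₀ (mem_univ _)), map_zero]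
    have hp := totalDegree_knapsackQuartic hn ((k : ℝ) + 1 / 2)
    have hp0 : knapsackQuartic n ((k : ℝ) + 1 / 2) ≠ 0 := by
      intro h0; rw [h0, MvPolynomial.totalDegree_zero] at hp; omega
    have h1 := MvPolynomial.totalDegree_mul_of_isDomain hp0 hne
    have h2 : (∑ j, h j ^ 2).totalDegree ≤ 2 :=
      MvPolynomial.totalDegree_finsetSum_le fun j _ =>
        (MvPolynomial.totalDegree_pow _ _).trans (by have := hh j; omega)
    rw [heq, hp] at h1
    omega
  · have hkn : (2 * k : ℝ) ≤ n := by exact_mod_cast (by omega : 2 * k ≤ n)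
    have hpos : ∀ F ∈ cubeDegreeLE n k, 0 ≤ pseudoExp n ((k : ℝ) + 1 / 2) (F * F) := by
      refine fun F hF => pseudoExp_mul_self_nonneg _ (by omega) (fun j hj => ?_) hF
      have : (j : ℝ) ≤ k := by exact_mod_cast hj
      exact pseudoMoment_nonneg (by omega) (by linarith) (by linarith)
    have hpos' : ∀ F ∈ cubeDegreeLE n (k - 2 + 1),
        0 ≤ pseudoExp n ((k : ℝ) + 1 / 2) (F * F) :=
      fun F hF => hpos F (cubeDegreeLE_mono (by omega) hF)
    have hw : ∑ T : Finset (Fin n), pseudoMoment n ((k : ℝ) + 1 / 2) T.card Tᶜ.card ≠ 0 := by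
      have h1 := pseudoExp_cubeMonomial ((k : ℝ) + 1 / 2) (∅ : Finset (Fin n))
      rw [pseudoExp_apply] at h1
      simp only [cubeMonomial, empty_subset, if_true, mul_one] at h1
      rw [h1]
      simp [pseudoMoment]
    obtain ⟨c, hc, hne⟩ := MvPolynomial.exists_sum_eval_add_ne_zero (pow_ne_zero 2 hi₀)
      (fun T : Finset (Fin n) => pseudoMoment n ((k : ℝ) + 1 / 2) T.card Tᶜ.card)
      (fun T i => if i ∈ T then 1 else 0) hw
      (Set.Icc_infinite (show (0 : ℝ) < 1 / (64 * n ^ 2) by positivity))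
    let ev : MvPolynomial (Fin n) ℝ → Finset (Fin n) → ℝ :=
      fun q T => MvPolynomial.eval (cubePoint c T) q
    have hγ : ∀ i, ev (g i) ∈ cubeDegreeLE n (k - 2) := fun i => eval_cubePoint_mem c (hg i)
    have hle := fun i => pseudoExp_knapsackQuartic_mul_sq_le hn (by omega) hpos' (hγ i) hc
    have hγ0 : ∀ i ∈ univ, 0 ≤ pseudoExp n ((k : ℝ) + 1 / 2) (ev (g i) * ev (g i)) :=
      fun i _ => hpos' _ (cubeDegreeLE_mono (by omega) (hγ i))
    have hev : ∑ i, ev (knapsackQuartic n (k + 1 / 2)) * (ev (g i) * ev (g i)) =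
        ∑ j, ev (h j) * ev (h j) := by
      ext T
      have := congrArg (MvPolynomial.eval (cubePoint c T)) heq
      simpa only [map_mul, map_sum, map_pow, sq, mul_sum, Finset.sum_apply, Pi.mul_apply, ev]
        using this
    have hev' := congrArg (pseudoExp n ((k : ℝ) + 1 / 2)) hev
    rw [map_sum, map_sum] at hev'
    have hr : 0 ≤ ∑ j, pseudoExp n ((k : ℝ) + 1 / 2) (ev (h j) * ev (h j)) :=
      sum_nonneg fun j _ => hpos _ (eval_cubePoint_mem c (hh j))
    have hl := sum_le_sum fun i (_ : i ∈ univ) => hle i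
    rw [← mul_sum] at hl
    have hs := single_le_sum hγ0 (mem_univ i₀)
    refine hne (le_antisymm ?_ ?_)
    · have : pseudoExp n ((k : ℝ) + 1 / 2) (ev (g i₀) * ev (g i₀)) ≤ 0 := by
        have hl' := hev'.symm.trans_le hl
        linarith
      rw [pseudoExp_apply] at this
      simpa [ev, cubePoint, sq] using this
    · have := hγ0 i₀ (mem_univ _)
      rw [pseudoExp_apply] at this
      simpa [ev, cubePoint, sq] using this
end

section
/- Let d = ⌊n/2⌋, let X be a subset of the hypercube C = {0,1}^n, and let p be a polynomial of total degree at most 2 with p(x) > 0 for every x ∈ X. Then there exist polynomials q_1,…,q_m of total degree at most d, polynomials r_1,…,r_l of total degree at most d+1, and a real constant c > 0, such that p(x)·(1 + q_1(x)² + … + q_m(x)²) = c + r_1(x)² + … + r_l(x)² for all x ∈ X. -/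
open MvPolynomial Module

/-- In finite dimension, a convex cone that is not the whole space lies in a closed half-space,
even if the cone is not closed. -/
theorem PointedCone.exists_dual_ne_zero_nonneg {E : Type*} [NormedAddCommGroup E]
    [NormedSpace ℝ E] [FiniteDimensional ℝ E] (K : PointedCone ℝ E) {v : E} (hv : v ∉ K) :
    ∃ L : Dual ℝ E, L ≠ 0 ∧ ∀ x ∈ K, 0 ≤ L x := by
  have hconv : Convex ℝ (K : Set E) := K.convex
  by_cases hint : (interior (K : Set E)).Nonempty
  · obtain ⟨f, hf⟩ := geometric_hahn_banach_open_point hconv.interior isOpen_interior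
      (fun h => hv (interior_subset h))
    have hle : ∀ x ∈ K, f x ≤ f v := fun x hx => by
      have hx' : x ∈ closure (interior (K : Set E)) := by
        rw [hconv.closure_interior_eq_closure_of_nonempty_interior hint]
        exact subset_closure hx
      exact closure_minimal (fun a ha => (hf a ha).le)
        (isClosed_le f.continuous continuous_const) hx'
    refine ⟨-f.toLinearMap, ?_, fun x hx => ?_⟩
    · intro h0
      obtain ⟨a, ha⟩ := hint
      have h1 := hf a ha
      have h2 : ∀ y, f y = 0 := fun y => by simpa using LinearMap.congr_fun h0 y
      simp [h2] at h1
    · by_contra hneg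
      have hpos : 0 < f x := by simpa using hneg
      have hv0 : 0 ≤ f v := by simpa using hle 0 K.zero_mem
      have h := hle (((f v + 1) / f x) • x) (PointedCone.smul_mem K (by positivity) hx)
      rw [map_smul, smul_eq_mul, div_mul_cancel₀ _ hpos.ne'] at h
      linarith
  · have hspan : Submodule.span ℝ (K : Set E) < ⊤ := by
      refine lt_top_iff_ne_top.mpr fun h => hint ?_
      rw [hconv.interior_nonempty_iff_affineSpan_eq_top,
        ← Set.insert_eq_of_mem (show (0 : E) ∈ (K : Set E) from K.zero_mem)]
      apply SetLike.coe_injective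
      rw [affineSpan_insert_zero, h]
      simp
    obtain ⟨f, hf, hle⟩ := Submodule.exists_le_ker_of_lt_top _ hspan
    exact ⟨f, hf, fun x hx => (hle (Submodule.subset_span hx)).ge⟩

section

variable {n : ℕ} {ι : Type*}

/-- Functions on a family of points `e` given by polynomials of degree less than `k`. -/
noncomputable def polyFunctions (e : ι → Fin n → ℝ) (k : ℕ) : Submodule ℝ (ι → ℝ) :=
  (restrictSupport ℝ {s | s.degree < k}).map
    (LinearMap.pi fun a => (aeval (R := ℝ) (e a)).toLinearMap)

theorem mem_polyFunctions {e : ι → Fin n → ℝ} {k : ℕ} {f : ι → ℝ} :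
    f ∈ polyFunctions e k ↔
      ∃ p : MvPolynomial (Fin n) ℝ, (∀ s ∈ p.support, s.degree < k) ∧ ∀ a, eval (e a) p = f a := by
  simp only [polyFunctions, Submodule.mem_map, mem_restrictSupport_iff, Set.subset_def,
    Finset.mem_coe, Set.mem_ofPred_eq, funext_iff, LinearMap.pi_apply, AlgHom.toLinearMap_apply,
    ← coe_aeval_eq_eval, RingHom.coe_coe]

theorem exists_totalDegree_le_of_mem_polyFunctions {e : ι → Fin n → ℝ} {k : ℕ} {f : ι → ℝ}
    (hf : f ∈ polyFunctions e (k + 1)) :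
    ∃ p : MvPolynomial (Fin n) ℝ, p.totalDegree ≤ k ∧ ∀ a, eval (e a) p = f a := by
  obtain ⟨p, hp, hpf⟩ := mem_polyFunctions.mp hf
  exact ⟨p, Finset.sup_le fun s hs => Nat.lt_succ_iff.mp (hp s hs), hpf⟩

theorem eval_mem_polyFunctions (e : ι → Fin n → ℝ) {k : ℕ} {p : MvPolynomial (Fin n) ℝ}
    (hp : p.totalDegree < k) : (fun a => eval (e a) p) ∈ polyFunctions e k :=
  mem_polyFunctions.mpr ⟨p, fun _ hs => (le_totalDegree hs).trans_lt hp, fun _ => rfl⟩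

theorem polyFunctions_mono (e : ι → Fin n → ℝ) : Monotone (polyFunctions e) := fun _ _ h =>
  Submodule.map_mono (restrictSupport_mono ℝ fun _ hs => lt_of_lt_of_le hs h)

theorem mul_coord_mem_polyFunctions {e : ι → Fin n → ℝ} {k : ℕ} {f : ι → ℝ}
    (hf : f ∈ polyFunctions e k) (i : Fin n) :
    (fun a => f a * e a i) ∈ polyFunctions e (k + 1) := by
  obtain ⟨p, hp, hpf⟩ := mem_polyFunctions.mp hf
  refine mem_polyFunctions.mpr ⟨p * X i, fun s hs => ?_, fun a => by simp [hpf]⟩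
  rw [support_mul_X, Finset.mem_map] at hs
  obtain ⟨t, ht, rfl⟩ := hs
  simpa using hp t ht

/-- The parity character of a vertex of the hypercube, up to a global sign. -/
noncomputable def cubeSign (x : Fin n → ℝ) : ℝ := ∏ i, (2 * x i - 1)

theorem cubeSign_ne_zero {x : Fin n → ℝ} (hx : x ∈ cube n) : cubeSign x ≠ 0 :=
  Finset.prod_ne_zero_iff.mpr fun i _ => by rcases hx i with h | h <;> norm_num [h]

theorem prod_add_sub_one_self {x : Fin n → ℝ} :
    ∏ i, (x i - 1 + x i) = cubeSign x :=
  Finset.prod_congr rfl fun i _ => by ring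

theorem prod_add_sub_one_of_ne {x y : Fin n → ℝ} (hx : x ∈ cube n) (hy : y ∈ cube n)
    (hxy : x ≠ y) : ∏ i, (x i - 1 + y i) = 0 := by
  obtain ⟨i, hi⟩ := Function.ne_iff.mp hxy
  refine Finset.prod_eq_zero (Finset.mem_univ i) ?_
  rcases hx i with h | h <;> rcases hy i with h' | h' <;> simp_all

theorem eval_mem_of_polyFunctions_le {e : ι → Fin n → ℝ} {k : ℕ}
    (h : polyFunctions e (k + 1) ≤ polyFunctions e k) (p : MvPolynomial (Fin n) ℝ) :
    (fun a => eval (e a) p) ∈ polyFunctions e k := by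
  induction p using MvPolynomial.induction_on with
  | C c => exact h (eval_mem_polyFunctions e (by simp))
  | add p q hp hq => simpa using! Submodule.add_mem _ hp hq
  | mul_X p i hp => simpa using h (mul_coord_mem_polyFunctions hp i)

/-- The cone of sums of squares of polynomials of degree at most `k`, as functions on a family
of points. -/
noncomputable def sosCone (e : ι → Fin n → ℝ) (k : ℕ) : PointedCone ℝ (ι → ℝ) where
  carrier := {f | ∃ (m : ℕ) (q : Fin m → MvPolynomial (Fin n) ℝ),
    (∀ i, (q i).totalDegree ≤ k) ∧ ∀ a, f a = ∑ i, eval (e a) (q i) ^ 2}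
  zero_mem' := ⟨0, Fin.elim0, fun i => i.elim0, by simp⟩
  add_mem' := by
    rintro f g ⟨m, q, hq, hf⟩ ⟨l, r, hr, hg⟩
    refine ⟨m + l, Fin.append q r, fun i => ?_, fun a => ?_⟩
    · refine Fin.addCases (fun i => ?_) (fun i => ?_) i
      · simpa using hq i
      · simpa using hr i
    · simp [Fin.sum_univ_add, hf, hg]
  smul_mem' := by
    rintro ⟨c, hc⟩ f ⟨m, q, hq, hf⟩
    refine ⟨m, fun i => √c • q i, fun i => (totalDegree_smul_le _ _).trans (hq i), fun a => ?_⟩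
    simp [smul_eval, mul_pow, Real.sq_sqrt hc, hf, Finset.mul_sum, Nonneg.mk_smul]

theorem mem_sosCone {e : ι → Fin n → ℝ} {k : ℕ} {f : ι → ℝ} :
    f ∈ sosCone e k ↔ ∃ (m : ℕ) (q : Fin m → MvPolynomial (Fin n) ℝ),
      (∀ i, (q i).totalDegree ≤ k) ∧ ∀ a, f a = ∑ i, eval (e a) (q i) ^ 2 := Iff.rfl

theorem sq_mem_sosCone (e : ι → Fin n → ℝ) {k : ℕ} {q : MvPolynomial (Fin n) ℝ}
    (hq : q.totalDegree ≤ k) : (fun a => eval (e a) q ^ 2) ∈ sosCone e k :=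
  ⟨1, fun _ => q, fun _ => hq, fun a => by simp⟩

theorem finrank_le_card_pos_of_nonneg [Fintype ι] (W : Submodule ℝ (ι → ℝ)) {w : ι → ℝ}
    (hw : ∀ a, w a ≠ 0) (hW : ∀ g ∈ W, 0 ≤ ∑ a, w a * g a ^ 2) :
    finrank ℝ W ≤ {a | 0 < w a}.ncard := by
  classical
  let R : W →ₗ[ℝ] ({a | 0 < w a} → ℝ) := (LinearMap.funLeft ℝ ℝ Subtype.val).comp W.subtype
  have hR : Function.Injective R := by
    refine (injective_iff_map_eq_zero _).mpr fun g hg => Subtype.ext (funext fun a => ?_)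
    have hpos : ∀ b, 0 < w b → (g : ι → ℝ) b = 0 := fun b hb => congrFun hg ⟨b, hb⟩
    have hnonpos : ∀ b ∈ Finset.univ, w b * (g : ι → ℝ) b ^ 2 ≤ 0 := fun b _ => by
      rcases lt_or_ge 0 (w b) with hb | hb
      · simp [hpos b hb]
      · exact mul_nonpos_of_nonpos_of_nonneg hb (sq_nonneg _)
    have h0 := (Finset.sum_eq_zero_iff_of_nonpos hnonpos).mp
      (le_antisymm (Finset.sum_nonpos hnonpos) (hW g g.2)) a (Finset.mem_univ a)
    simpa [hw a] using h0
  refine (LinearMap.finrank_le_finrank_of_injective hR).trans (le_of_eq ?_)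
  rw [finrank_fintype_fun_eq_card, ← Nat.card_eq_fintype_card, Nat.card_coe_set_eq]

variable [DecidableEq ι]

/-- Multiplication by the parity character, on functionals identified with functions. -/
noncomputable def signTwist (e : ι → Fin n → ℝ) : Dual ℝ (ι → ℝ) →ₗ[ℝ] (ι → ℝ) :=
  LinearMap.pi fun a => cubeSign (e a) • LinearMap.applyₗ (Pi.single a 1)

theorem signTwist_apply (e : ι → Fin n → ℝ) (φ : Dual ℝ (ι → ℝ)) (a : ι) :
    signTwist e φ a = cubeSign (e a) * φ (Pi.single a 1) := rfl

variable [Fintype ι]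

theorem dual_apply_eq_sum (φ : Dual ℝ (ι → ℝ)) (f : ι → ℝ) :
    φ f = ∑ a, f a * φ (Pi.single a 1) := by
  rw [LinearMap.pi_apply_eq_sum_univ φ f]
  simp only [smul_eq_mul]
  refine Finset.sum_congr rfl fun a _ => ?_
  congr 2
  ext b
  simp [Pi.single_apply, eq_comm]

theorem signTwist_injective {e : ι → Fin n → ℝ} (hcube : ∀ a, e a ∈ cube n) :
    Function.Injective (signTwist e) := by
  refine (injective_iff_map_eq_zero _).mpr fun φ hφ => LinearMap.ext fun f => ?_
  rw [dual_apply_eq_sum]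
  refine Finset.sum_eq_zero fun a _ => ?_
  have h := congrFun hφ a
  rw [signTwist_apply] at h
  rw [(mul_eq_zero.mp h).resolve_left (cubeSign_ne_zero (hcube a)), mul_zero]

/-- A functional vanishing on polynomials of degree less than `k` becomes, after multiplication by
the parity character, a polynomial of degree at most `n - k`. -/
theorem signTwist_mem_polyFunctions {e : ι → Fin n → ℝ} (hcube : ∀ a, e a ∈ cube n)
    (hinj : Function.Injective e) {k m : ℕ} (hkm : n + 1 ≤ k + m) {φ : Dual ℝ (ι → ℝ)}
    (hφ : φ ∈ (polyFunctions e k).dualAnnihilator) : signTwist e φ ∈ polyFunctions e m := by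
  have hexp : signTwist e φ = ∑ S : Finset (Fin n),
      φ (fun a => ∏ i ∈ Sᶜ, e a i) • fun b => ∏ i ∈ S, (e b i - 1) := by
    ext b
    have h1 : signTwist e φ b = φ (fun a => ∏ i, (e b i - 1 + e a i)) := by
      rw [signTwist_apply, dual_apply_eq_sum φ (fun a => ∏ i, (e b i - 1 + e a i)),
        Finset.sum_eq_single b]
      · rw [prod_add_sub_one_self]
      · intro a _ hab
        rw [prod_add_sub_one_of_ne (hcube b) (hcube a) (hinj.ne hab.symm), zero_mul]
      · simp
    have h2 : (fun a => ∏ i, (e b i - 1 + e a i)) = ∑ S : Finset (Fin n),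
        (∏ i ∈ S, (e b i - 1)) • fun a => ∏ i ∈ Sᶜ, e a i := by
      ext a
      simp [Fintype.prod_add]
    rw [h1, h2, map_sum, Finset.sum_apply]
    refine Finset.sum_congr rfl fun S _ => ?_
    simp [mul_comm]
  rw [hexp]
  refine Submodule.sum_mem _ fun S _ => ?_
  have hcard : S.card + Sᶜ.card = n := by simp
  by_cases hS : Sᶜ.card < k
  · have hmem : (fun a => ∏ i ∈ Sᶜ, e a i) ∈ polyFunctions e k := by
      have hdeg : (∏ i ∈ Sᶜ, X i : MvPolynomial (Fin n) ℝ).totalDegree < k :=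
        (totalDegree_finsetProd _ _).trans_lt (by simpa using hS)
      simpa [eval_prod] using eval_mem_polyFunctions e hdeg
    rw [(Submodule.mem_dualAnnihilator φ).mp hφ _ hmem, zero_smul]
    exact Submodule.zero_mem _
  · refine Submodule.smul_mem _ _ ?_
    have hdeg : (∏ i ∈ S, (X i - C 1) : MvPolynomial (Fin n) ℝ).totalDegree < m := by
      refine (totalDegree_finsetProd _ _).trans_lt (lt_of_le_of_lt
        (Finset.sum_le_card_nsmul S _ 1 fun i _ => ?_) ?_)
      · exact (totalDegree_sub_C_le _ _).trans (totalDegree_X i).le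
      · simp only [smul_eq_mul, mul_one]; omega
    simpa [eval_prod] using eval_mem_polyFunctions e hdeg

theorem card_le_finrank_add_finrank {e : ι → Fin n → ℝ} (hcube : ∀ a, e a ∈ cube n)
    (hinj : Function.Injective e) {k m : ℕ} (hkm : n + 1 ≤ k + m) :
    Fintype.card ι ≤ finrank ℝ (polyFunctions e k) + finrank ℝ (polyFunctions e m) := by
  have h1 := Subspace.finrank_add_finrank_dualAnnihilator_eq (polyFunctions e k)
  rw [finrank_fintype_fun_eq_card] at h1
  have h2 : finrank ℝ (polyFunctions e k).dualAnnihilator ≤ finrank ℝ (polyFunctions e m) :=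
    LinearMap.finrank_le_finrank_of_injective
      (f := (signTwist e).restrict fun φ hφ => signTwist_mem_polyFunctions hcube hinj hkm hφ)
      fun x y hxy => Subtype.ext (signTwist_injective hcube (congrArg Subtype.val hxy))
  omega

theorem polyFunctions_eq_top_of_le {e : ι → Fin n → ℝ} (hcube : ∀ a, e a ∈ cube n)
    (hinj : Function.Injective e) {k : ℕ}
    (h : polyFunctions e (k + 1) ≤ polyFunctions e k) : polyFunctions e k = ⊤ := by
  have hle : ∀ m, polyFunctions e m ≤ polyFunctions e k := fun m f hf => by
    obtain ⟨p, -, hp⟩ := mem_polyFunctions.mp hf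
    simpa [hp] using eval_mem_of_polyFunctions_le h p
  have hbot : polyFunctions e 0 = ⊥ := by
    refine (Submodule.eq_bot_iff _).mpr fun f hf => ?_
    obtain ⟨p, hp, hpf⟩ := mem_polyFunctions.mp hf
    have hp0 : p = 0 := support_eq_empty.mp
      (Finset.eq_empty_of_forall_notMem fun s hs => Nat.not_lt_zero _ (hp s hs))
    ext a
    simp [← hpf, hp0]
  have hcard := card_le_finrank_add_finrank hcube hinj (k := n + 1) (m := 0) le_rfl
  rw [hbot, finrank_bot, add_zero] at hcard
  refine Submodule.eq_top_of_finrank_eq (le_antisymm (Submodule.finrank_le _) ?_)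
  rw [finrank_fintype_fun_eq_card]
  exact hcard.trans (Submodule.finrank_mono (hle _))

theorem card_lt_finrank_add_finrank [Nonempty ι] {e : ι → Fin n → ℝ}
    (hcube : ∀ a, e a ∈ cube n) (hinj : Function.Injective e) {d : ℕ} (hd : n ≤ 2 * d + 1) :
    Fintype.card ι <
      finrank ℝ (polyFunctions e (d + 2)) + finrank ℝ (polyFunctions e (d + 1)) := by
  by_cases h : polyFunctions e (d + 1) ≤ polyFunctions e d
  · have htop := polyFunctions_eq_top_of_le hcube hinj h
    have h1 : polyFunctions e (d + 1) = ⊤ :=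
      top_le_iff.mp (htop ▸ polyFunctions_mono e (Nat.le_succ d))
    have h2 : polyFunctions e (d + 2) = ⊤ :=
      top_le_iff.mp (h1 ▸ polyFunctions_mono e (Nat.le_succ (d + 1)))
    rw [h1, h2, finrank_top, finrank_fintype_fun_eq_card]
    have := Fintype.card_pos (α := ι)
    omega
  · have hlt : polyFunctions e d < polyFunctions e (d + 1) :=
      lt_of_le_not_ge (polyFunctions_mono e (Nat.le_succ d)) h
    have h1 := Submodule.finrank_lt_finrank_of_lt hlt
    have h2 := card_le_finrank_add_finrank hcube hinj (k := d + 2) (m := d) (by omega)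
    omega

/-- A functional nonnegative on squares of degree `d + 1` and nonpositive on `u` times squares of
degree `d`, where `u` is positive, vanishes. -/
theorem dual_eq_zero_of_sq_nonneg_of_mul_sq_nonpos {e : ι → Fin n → ℝ}
    (hcube : ∀ a, e a ∈ cube n) (hinj : Function.Injective e) {d : ℕ} (hd : n ≤ 2 * d + 1)
    {u : ι → ℝ} (hu : ∀ a, 0 < u a) {L : Dual ℝ (ι → ℝ)}
    (hsq : ∀ q : MvPolynomial (Fin n) ℝ, q.totalDegree ≤ d + 1 →
      0 ≤ L fun a => eval (e a) q ^ 2)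
    (hmul : ∀ q : MvPolynomial (Fin n) ℝ, q.totalDegree ≤ d →
      L (fun a => u a * eval (e a) q ^ 2) ≤ 0) : L = 0 := by
  by_contra hL
  let w : ι → ℝ := fun a => L (Pi.single a 1)
  let Y := {a : ι // w a ≠ 0}
  have hsum : ∀ f : ι → ℝ, L f = ∑ y : Y, w y * f y := fun f => by
    have hzero : ∑ a : {a : ι // ¬ w a ≠ 0}, w a * f a = 0 :=
      Finset.sum_eq_zero fun a _ => by rw [not_not.mp a.2, zero_mul]
    have h := Fintype.sum_subtype_add_sum_subtype (fun a => w a ≠ 0) (fun a => w a * f a)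
    rw [hzero, add_zero] at h
    rw [dual_apply_eq_sum, h]
    exact Finset.sum_congr rfl fun a _ => mul_comm _ _
  have hY : Nonempty Y := by
    by_contra hemp
    rw [not_nonempty_iff] at hemp
    exact hL (LinearMap.ext fun f => by simp [hsum])
  have hpos : finrank ℝ (polyFunctions (fun y : Y => e y) (d + 2)) ≤ {y : Y | 0 < w y}.ncard := by
    refine finrank_le_card_pos_of_nonneg _ (fun y => y.2) fun g hg => ?_
    obtain ⟨q, hq, hqg⟩ := exists_totalDegree_le_of_mem_polyFunctions hg
    simpa [hsum, hqg] using hsq q hq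
  have hneg : finrank ℝ (polyFunctions (fun y : Y => e y) (d + 1)) ≤
      {y : Y | 0 < -(w y * u y)}.ncard := by
    refine finrank_le_card_pos_of_nonneg _
      (fun y => neg_ne_zero.mpr (mul_ne_zero y.2 (hu y).ne')) fun g hg => ?_
    obtain ⟨q, hq, hqg⟩ := exists_totalDegree_le_of_mem_polyFunctions hg
    simpa [hsum, hqg, mul_assoc] using hmul q hq
  have hcompl : {y : Y | 0 < -(w y * u y)} = {y : Y | 0 < w y}ᶜ := by
    ext y
    simp only [Set.mem_ofPred_eq, Set.mem_compl_iff, not_lt, neg_pos]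
    rw [mul_neg_iff]
    have := hu y
    exact ⟨by rintro (⟨-, h⟩ | ⟨h, -⟩) <;> linarith, fun h => Or.inr ⟨lt_of_le_of_ne h y.2, this⟩⟩
  have hcard := Set.ncard_add_ncard_compl {y : Y | 0 < w y}
  have hlt := card_lt_finrank_add_finrank (e := fun y : Y => e y) (fun y => hcube y)
    (hinj.comp Subtype.val_injective) hd
  rw [hcompl] at hneg
  rw [Nat.card_eq_fintype_card] at hcard
  omega

end


theorem stmt4 (n d : ℕ) (hd : d = n / 2) (X : Set (Fin n → ℝ)) (hX : X ⊆ cube n)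
    (p : MvPolynomial (Fin n) ℝ) (hdeg : p.totalDegree ≤ 2)
    (hpos : ∀ x ∈ X, 0 < MvPolynomial.eval x p) :
    ∃ (m l : ℕ) (q : Fin m → MvPolynomial (Fin n) ℝ)
      (r : Fin l → MvPolynomial (Fin n) ℝ) (c : ℝ),
      (∀ i, (q i).totalDegree ≤ d) ∧ (∀ j, (r j).totalDegree ≤ d + 1) ∧ 0 < c ∧
      ∀ x ∈ X, MvPolynomial.eval x p * (1 + ∑ i, (MvPolynomial.eval x (q i)) ^ 2) =
        c + ∑ j, (MvPolynomial.eval x (r j)) ^ 2 := by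
  have hfin : X.Finite := (Set.Finite.pi fun _ : Fin n => Set.toFinite ({0, 1} : Set ℝ)).subset
    fun x hx i _ => hX hx i
  have := hfin.fintype
  classical
  let e : X → Fin n → ℝ := Subtype.val
  let u : X → ℝ := fun x => eval (e x) p
  let K : PointedCone ℝ (X → ℝ) :=
    sosCone e (d + 1) ⊔ (sosCone e d).map (-LinearMap.mulLeft ℝ u)
  have hmem : u - 1 ∈ K := by
    by_contra hv
    obtain ⟨L, hL, hnonneg⟩ := K.exists_dual_ne_zero_nonneg hv
    refine hL (dual_eq_zero_of_sq_nonneg_of_mul_sq_nonpos (e := e) (d := d) (u := u)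
      (fun x => hX x.2) Subtype.val_injective (by omega) (fun x => hpos x x.2)
      (fun q hq => hnonneg _ (Submodule.mem_sup_left (sq_mem_sosCone e hq))) fun q hq => ?_)
    have h := hnonneg _ (Submodule.mem_sup_right
      (Submodule.mem_map_of_mem (sq_mem_sosCone e hq)))
    have h' : 0 ≤ L (-(fun a => u a * eval (e a) q ^ 2)) := h
    rw [map_neg] at h'
    linarith
  obtain ⟨s, hs, t, ht, hst⟩ := Submodule.mem_sup.mp hmem
  obtain ⟨σ, hσ, rfl⟩ := Submodule.mem_map.mp ht
  obtain ⟨l, r, hr, hsr⟩ := mem_sosCone.mp hs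
  obtain ⟨m, q, hq, hσq⟩ := mem_sosCone.mp hσ
  refine ⟨m, l, q, r, 1, hq, hr, one_pos, fun x hx => ?_⟩
  have h : s ⟨x, hx⟩ + -(u ⟨x, hx⟩ * σ ⟨x, hx⟩) = u ⟨x, hx⟩ - 1 := congrFun hst ⟨x, hx⟩
  rw [hsr, hσq] at h
  change _ + -(eval x p * _) = eval x p - 1 at h
  linear_combination -h
end

section
/- Let d = ⌊n/2⌋, let X be a subset of the hypercube C = {0,1}^n, and let p be a polynomial of total degree at most 2 with p(x) ≥ 0 for every x ∈ X and p not identically zero on X. Then there exist polynomials q_1,…,q_m of total degree at most d+1 and polynomials s_1,…,s_l of total degree at most d+2 such that p(x)·(1 + q_1(x)² + … + q_m(x)²) = s_1(x)² + … + s_l(x)² for all x ∈ X. -/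
noncomputable section

open Module Finset

/-- The functions vanishing on `Z`. -/
def vanishing {α : Type*} (Z : Finset α) : Submodule ℝ (α → ℝ) where
  carrier := {f | ∀ x ∈ Z, f x = 0}
  add_mem' hf hg x hx := by simp [hf x hx, hg x hx]
  zero_mem' x _ := rfl
  smul_mem' c f hf x hx := by simp [hf x hx]

theorem mem_vanishing {α : Type*} {Z : Finset α} {f : α → ℝ} :
    f ∈ vanishing Z ↔ ∀ x ∈ Z, f x = 0 := Iff.rfl

theorem vanishing_anti {α : Type*} {Z W : Finset α} (h : Z ⊆ W) :
    vanishing W ≤ vanishing Z := fun _ hf x hx => hf x (h hx)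

theorem finrank_vanishing {α : Type*} [Fintype α] (Z : Finset α) :
    finrank ℝ (vanishing Z) + #Z = Fintype.card α := by
  have hsurj : LinearMap.range (LinearMap.funLeft ℝ ℝ (Subtype.val : Z → α)) = ⊤ :=
    LinearMap.range_eq_top.2 <|
      LinearMap.funLeft_surjective_of_injective ℝ ℝ _ Subtype.val_injective
  have hker : LinearMap.ker (LinearMap.funLeft ℝ ℝ (Subtype.val : Z → α)) = vanishing Z := by
    ext f
    simp [mem_vanishing, funext_iff, LinearMap.funLeft_apply]
  have h := LinearMap.finrank_range_add_finrank_ker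
    (LinearMap.funLeft ℝ ℝ (Subtype.val : Z → α))
  rw [hsurj, hker, finrank_top, finrank_fintype_fun_eq_card, finrank_fintype_fun_eq_card,
    Fintype.card_coe] at h
  omega

theorem finrank_le_finrank_inf_vanishing {α : Type*} [Fintype α]
    (V : Submodule ℝ (α → ℝ)) (Z : Finset α) :
    finrank ℝ V ≤ finrank ℝ (V ⊓ vanishing Z : Submodule ℝ (α → ℝ)) + #Z := by
  have h := Submodule.finrank_sup_add_finrank_inf_eq V (vanishing Z)
  have h' := Submodule.finrank_le (V ⊔ vanishing Z)
  have hZ := finrank_vanishing Z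
  rw [finrank_fintype_fun_eq_card] at h'
  omega

theorem finrank_inf_vanishing_supermodular {α : Type*} [Fintype α]
    {V W : Submodule ℝ (α → ℝ)} (hVW : V ≤ W) {A B : Finset α} (hBA : B ⊆ A) :
    finrank ℝ (W ⊓ vanishing A : Submodule ℝ (α → ℝ)) +
        finrank ℝ (V ⊓ vanishing B : Submodule ℝ (α → ℝ)) ≤
      finrank ℝ (V ⊓ vanishing A : Submodule ℝ (α → ℝ)) +
        finrank ℝ (W ⊓ vanishing B : Submodule ℝ (α → ℝ)) := by
  rw [← Submodule.finrank_sup_add_finrank_inf_eq, add_comm]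
  refine add_le_add (Submodule.finrank_mono ?_) (Submodule.finrank_mono ?_)
  · exact fun f hf => ⟨hf.2.1, hf.1.2⟩
  · exact sup_le (inf_le_inf_left _ (vanishing_anti hBA)) (inf_le_inf_right _ hVW)

theorem finrank_map_add_finrank_inf_ker {E F : Type*} [AddCommGroup E] [Module ℝ E]
    [FiniteDimensional ℝ E] [AddCommGroup F] [Module ℝ F] (T : E →ₗ[ℝ] F) (S : Submodule ℝ E) :
    finrank ℝ (S.map T) + finrank ℝ (S ⊓ LinearMap.ker T : Submodule ℝ E) = finrank ℝ S := by
  have h := LinearMap.finrank_range_add_finrank_ker (T.domRestrict S)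
  rw [LinearMap.range_domRestrict, LinearMap.ker_domRestrict] at h
  rw [← h, ← Submodule.finrank_map_subtype_eq S, Submodule.map_comap_subtype]

/-- Restriction of a function on the cube to the face `x 0 = b`. -/
def face (n : ℕ) (b : Bool) : ((Fin (n + 1) → Bool) → ℝ) →ₗ[ℝ] ((Fin n → Bool) → ℝ) :=
  LinearMap.funLeft ℝ ℝ fun x => (Fin.cons b x : Fin (n + 1) → Bool)

/-- The discrete derivative in the first coordinate. -/
def diff (n : ℕ) : ((Fin (n + 1) → Bool) → ℝ) →ₗ[ℝ] ((Fin n → Bool) → ℝ) :=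
  face n true - face n false

/-- Inverse of `f ↦ (face n false f, diff n f)`. -/
def glue {n : ℕ} (f g : (Fin n → Bool) → ℝ) : (Fin (n + 1) → Bool) → ℝ :=
  fun x => f (Fin.tail x) + if x 0 then g (Fin.tail x) else 0

@[simp] theorem face_apply {n : ℕ} (b : Bool) (f : (Fin (n + 1) → Bool) → ℝ)
    (x : Fin n → Bool) : face n b f x = f (Fin.cons b x) := rfl

@[simp] theorem diff_apply {n : ℕ} (f : (Fin (n + 1) → Bool) → ℝ)
    (x : Fin n → Bool) : diff n f x = f (Fin.cons true x) - f (Fin.cons false x) := rfl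

@[simp] theorem face_glue {n : ℕ} (f g : (Fin n → Bool) → ℝ) : face n false (glue f g) = f := by
  ext x; simp [glue]

@[simp] theorem diff_glue {n : ℕ} (f g : (Fin n → Bool) → ℝ) : diff n (glue f g) = g := by
  ext x; simp [glue]

theorem glue_face_diff {n : ℕ} (f : (Fin (n + 1) → Bool) → ℝ) :
    glue (face n false f) (diff n f) = f := by
  ext x
  rw [← Fin.cons_self_tail x]
  cases x 0 <;> simp [glue]

/-- The functions on the cube of degree at most `k`. -/
def lowDeg : (n k : ℕ) → Submodule ℝ ((Fin n → Bool) → ℝ)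
  | 0, _ => ⊤
  | n + 1, 0 => (lowDeg n 0).comap (face n false) ⊓ LinearMap.ker (diff n)
  | n + 1, k + 1 => (lowDeg n (k + 1)).comap (face n false) ⊓ (lowDeg n k).comap (diff n)

theorem mem_lowDeg_succ_zero {n : ℕ} {f : (Fin (n + 1) → Bool) → ℝ} :
    f ∈ lowDeg (n + 1) 0 ↔ face n false f ∈ lowDeg n 0 ∧ diff n f = 0 := Iff.rfl

theorem mem_lowDeg_succ_succ {n k : ℕ} {f : (Fin (n + 1) → Bool) → ℝ} :
    f ∈ lowDeg (n + 1) (k + 1) ↔ face n false f ∈ lowDeg n (k + 1) ∧ diff n f ∈ lowDeg n k :=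
  Iff.rfl

theorem lowDeg_le_succ : ∀ n k : ℕ, lowDeg n k ≤ lowDeg n (k + 1)
  | 0, _ => le_rfl
  | n + 1, 0 => fun f hf => by
    rw [mem_lowDeg_succ_zero] at hf
    exact mem_lowDeg_succ_succ.2 ⟨lowDeg_le_succ n 0 hf.1, hf.2 ▸ zero_mem _⟩
  | n + 1, k + 1 => fun f hf => by
    rw [mem_lowDeg_succ_succ] at hf
    exact mem_lowDeg_succ_succ.2 ⟨lowDeg_le_succ n _ hf.1, lowDeg_le_succ n _ hf.2⟩

theorem lowDeg_eq_top : ∀ {n k : ℕ}, n ≤ k → lowDeg n k = ⊤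
  | 0, _, _ => rfl
  | n + 1, 0, h => by omega
  | n + 1, k + 1, h => by
    rw [lowDeg, lowDeg_eq_top (by omega : n ≤ k + 1), lowDeg_eq_top (by omega : n ≤ k)]
    simp

theorem one_mem_lowDeg : ∀ n k : ℕ, 1 ∈ lowDeg n k
  | 0, _ => trivial
  | n + 1, 0 => mem_lowDeg_succ_zero.2 ⟨one_mem_lowDeg n 0, by ext; simp⟩
  | n + 1, k + 1 => mem_lowDeg_succ_succ.2
      ⟨one_mem_lowDeg n (k + 1), by convert zero_mem (lowDeg n k); ext; simp⟩

theorem finrank_lowDeg_succ_succ (n k : ℕ) :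
    finrank ℝ (lowDeg n (k + 1)) + finrank ℝ (lowDeg n k) ≤
      finrank ℝ (lowDeg (n + 1) (k + 1)) := by
  rw [← finrank_map_add_finrank_inf_ker (diff n) (lowDeg (n + 1) (k + 1)), add_comm]
  refine add_le_add (Submodule.finrank_mono fun g hg => ?_) ?_
  · exact ⟨glue 0 g, mem_lowDeg_succ_succ.2 (by simpa using hg), by simp⟩
  · refine le_trans (Submodule.finrank_mono ?_) (Submodule.finrank_map_le (face n false) _)
    exact fun f hf => ⟨glue f 0, ⟨mem_lowDeg_succ_succ.2 (by simpa using hf), by simp⟩, by simp⟩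

/-- The points of the face `x 0 = b` of `Z`, with the first coordinate dropped. -/
def faceSet {n : ℕ} (Z : Finset (Fin (n + 1) → Bool)) (b : Bool) : Finset (Fin n → Bool) :=
  {x | (Fin.cons b x : Fin (n + 1) → Bool) ∈ Z}

theorem mem_faceSet {n : ℕ} {Z : Finset (Fin (n + 1) → Bool)} {b : Bool} {x : Fin n → Bool} :
    x ∈ faceSet Z b ↔ (Fin.cons b x : Fin (n + 1) → Bool) ∈ Z := by
  simp [faceSet]

theorem card_le_card_faceSet {n : ℕ} (Z : Finset (Fin (n + 1) → Bool)) :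
    #Z ≤ #(faceSet Z false ∪ faceSet Z true) + #(faceSet Z false ∩ faceSet Z true) := by
  rw [card_union_add_card_inter]
  have h : Z ⊆ (faceSet Z false).image (Fin.cons false) ∪ (faceSet Z true).image (Fin.cons true) := by
    intro x hx
    rw [← Fin.cons_self_tail x] at hx ⊢
    simp only [mem_union, mem_image, mem_faceSet]
    cases h : x 0
    · exact Or.inl ⟨_, h ▸ hx, rfl⟩
    · exact Or.inr ⟨_, h ▸ hx, rfl⟩
  exact (card_le_card h).trans <|
    (card_union_le _ _).trans (add_le_add card_image_le card_image_le)

/-- The dimension of the space of functions of degree at most `k` vanishing on `Z`. -/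
def nullity {n : ℕ} (k : ℕ) (Z : Finset (Fin n → Bool)) : ℕ :=
  finrank ℝ (lowDeg n k ⊓ vanishing Z : Submodule ℝ ((Fin n → Bool) → ℝ))

theorem nullity_succ_le {n : ℕ} (k : ℕ) (Z : Finset (Fin (n + 1) → Bool)) :
    nullity (k + 1) Z ≤ nullity (k + 1) (faceSet Z false ∪ faceSet Z true) +
      nullity k (faceSet Z false ∩ faceSet Z true) := by
  rw [nullity, ← finrank_map_add_finrank_inf_ker (diff n), add_comm]
  refine add_le_add ?_ (Submodule.finrank_mono ?_)
  · refine le_trans (Submodule.finrank_mono ?_) (Submodule.finrank_map_le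
      (LinearMap.funLeft ℝ ℝ fun x : Fin (n + 1) → Bool => (Fin.tail x : Fin n → Bool)) _)
    intro f hf
    refine ⟨face n false f, ⟨?_, ?_⟩, ?_⟩
    · exact hf.1.1.1
    · intro x hx
      have hd : diff n f x = 0 := congrFun hf.2 x
      rw [diff_apply] at hd
      rw [face_apply]
      rcases mem_union.1 hx with h | h
      · exact hf.1.2 _ (mem_faceSet.1 h)
      · linarith [hf.1.2 _ (mem_faceSet.1 h)]
    · ext x
      have hd : diff n f (Fin.tail x) = 0 := congrFun hf.2 _
      conv_rhs => rw [← glue_face_diff f]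
      simp only [LinearMap.funLeft_apply, glue, hd, ite_self, add_zero]
  · rintro _ ⟨f, hf, rfl⟩
    refine ⟨hf.1.2, fun x hx => ?_⟩
    rw [mem_inter, mem_faceSet, mem_faceSet] at hx
    rw [diff_apply, hf.2 _ hx.1, hf.2 _ hx.2, sub_zero]

theorem nullity_add_card_of_le {n k : ℕ} (h : n ≤ k) (Z : Finset (Fin n → Bool)) :
    nullity k Z + #Z = finrank ℝ (lowDeg n k) := by
  rw [nullity, lowDeg_eq_top h, top_inf_eq, finrank_vanishing, finrank_top,
    finrank_fintype_fun_eq_card]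

theorem nullity_empty {n : ℕ} (k : ℕ) :
    nullity k (∅ : Finset (Fin n → Bool)) = finrank ℝ (lowDeg n k) := by
  rw [nullity, show vanishing (∅ : Finset (Fin n → Bool)) = ⊤ by ext; simp [mem_vanishing],
    inf_top_eq]

theorem nullity_lt {n k : ℕ} {Z : Finset (Fin n → Bool)} (hZ : Z.Nonempty) :
    nullity k Z < finrank ℝ (lowDeg n k) := by
  obtain ⟨x, hx⟩ := hZ
  refine Submodule.finrank_lt_finrank_of_lt (inf_le_left.lt_of_ne fun h => ?_)
  have h1 := one_mem_lowDeg n k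
  rw [← h] at h1
  exact one_ne_zero (h1.2 x hx)

theorem nullity_add_nullity_lt : ∀ {n a b : ℕ}, n ≤ a + b → ∀ {Z : Finset (Fin n → Bool)},
    Z.Nonempty → nullity a Z + nullity b Z + #Z < finrank ℝ (lowDeg n a) + finrank ℝ (lowDeg n b)
  | n, a, 0, h, Z, hZ => by
    have := nullity_add_card_of_le (by omega : n ≤ a) Z
    have := nullity_lt (k := 0) hZ
    omega
  | n, 0, b + 1, h, Z, hZ => by
    have := nullity_add_card_of_le (by omega : n ≤ b + 1) Z
    have := nullity_lt (k := 0) hZ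
    omega
  | 0, a + 1, b + 1, h, Z, hZ => by
    have := nullity_add_card_of_le (by omega : 0 ≤ a + 1) Z
    have := nullity_lt (k := b + 1) hZ
    omega
  | n + 1, a + 1, b + 1, h, Z, hZ => by
    set A := faceSet Z false ∪ faceSet Z true with hA
    set B := faceSet Z false ∩ faceSet Z true with hB
    have hcard : #Z ≤ #A + #B := card_le_card_faceSet Z
    have hBA : B ⊆ A := inter_subset_left.trans subset_union_left
    have hAne : A.Nonempty := by
      rw [nonempty_iff_ne_empty]
      intro h0
      have hB0 : B = ∅ := subset_empty.1 (h0 ▸ hBA)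
      have := hZ.card_pos
      rw [h0, hB0, card_empty] at hcard
      omega
    have ha := nullity_succ_le a Z
    have hb := nullity_succ_le b Z
    have hsup : nullity (b + 1) A + nullity b B ≤ nullity b A + nullity (b + 1) B :=
      finrank_inf_vanishing_supermodular (lowDeg_le_succ n b) hBA
    have hIA := nullity_add_nullity_lt (by omega : n ≤ (a + 1) + b) hAne
    have hIB : nullity a B + nullity (b + 1) B + #B ≤
        finrank ℝ (lowDeg n a) + finrank ℝ (lowDeg n (b + 1)) := by
      rcases B.eq_empty_or_nonempty with h0 | h0
      · rw [h0, nullity_empty, nullity_empty, card_empty]; omega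
      · exact (nullity_add_nullity_lt (by omega : n ≤ a + (b + 1)) h0).le
    have hDa := finrank_lowDeg_succ_succ n a
    have hDb := finrank_lowDeg_succ_succ n b
    rw [← hA, ← hB] at ha hb
    omega

theorem exists_idempotent_factors : ∀ {n k l : ℕ}, n ≤ k + l → ∀ e : Fin n → Bool,
    ∃ a ∈ lowDeg n k, ∃ b ∈ lowDeg n l, a ^ 2 = a ∧ b ^ 2 = b ∧ a * b = Pi.single e 1
  | n, 0, l, h, e => ⟨1, one_mem_lowDeg n 0, Pi.single e 1,
      lowDeg_eq_top (by omega : n ≤ l) ▸ Submodule.mem_top, one_pow 2,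
      by ext x; by_cases h : x = e <;> simp [h], one_mul _⟩
  | 0, k + 1, l, h, e => ⟨1, trivial, 1, trivial, one_pow 2, one_pow 2, by
      ext x
      rw [Subsingleton.elim x e]
      simp⟩
  | n + 1, k + 1, l, h, e => by
    obtain ⟨a, ha, b, hb, ha2, hb2, hab⟩ :=
      exists_idempotent_factors (by omega : n ≤ k + l) (Fin.tail e)
    have ha2' (x) : a x ^ 2 = a x := congrFun ha2 x
    have hb2' (x) : b x ^ 2 = b x := congrFun hb2 x
    have hab' (x) : a x * b x = (Pi.single (Fin.tail e) 1 : (Fin n → Bool) → ℝ) x :=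
      congrFun hab x
    have hsingle (x : Fin (n + 1) → Bool) : (Pi.single e 1 : (Fin (n + 1) → Bool) → ℝ) x =
        if x 0 = e 0 then (Pi.single (Fin.tail e) 1 : (Fin n → Bool) → ℝ) (Fin.tail x) else 0 := by
      have : x = e ↔ x 0 = e 0 ∧ Fin.tail x = Fin.tail e := by
        constructor
        · rintro rfl; simp
        · rintro ⟨h0, h1⟩
          rw [← Fin.cons_self_tail x, ← Fin.cons_self_tail e, h0, h1]
      simp only [Pi.single_apply, this, ite_and]
    have hbmem : glue b 0 ∈ lowDeg (n + 1) l := by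
      cases l with
      | zero => exact mem_lowDeg_succ_zero.2 (by simpa using hb)
      | succ l => exact mem_lowDeg_succ_succ.2 (by simpa using hb)
    cases he : e 0 with
    | true =>
      refine ⟨glue 0 a, mem_lowDeg_succ_succ.2 (by simpa using ha), glue b 0, hbmem, ?_, ?_, ?_⟩
      · ext x; cases hx : x 0 <;> simp [glue, hx, ha2']
      · ext x; simp [glue, hb2']
      · ext x; rw [hsingle]; cases hx : x 0 <;> simp [glue, hx, he, hab']
    | false =>
      refine ⟨glue a (-a), mem_lowDeg_succ_succ.2
        (by simpa using ⟨lowDeg_le_succ n k ha, ha⟩), glue b 0, hbmem, ?_, ?_, ?_⟩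
      · ext x; cases hx : x 0 <;> simp [glue, hx, ha2']
      · ext x; simp [glue, hb2']
      · ext x; rw [hsingle]; cases hx : x 0 <;> simp [glue, hx, he, hab']

/-- The vertex of the cube with the given coordinates. -/
def vertex {n : ℕ} (x : Fin n → Bool) : Fin n → ℝ := fun i => if x i then 1 else 0

theorem exists_vertex_eq {n : ℕ} {y : Fin n → ℝ} (hy : y ∈ cube n) : ∃ x, vertex x = y := by
  classical
  refine ⟨fun i => decide (y i = 1), funext fun i => ?_⟩
  rcases hy i with h | h <;> simp [vertex, h]

theorem exists_polynomial_of_mem_lowDeg : ∀ {n k : ℕ} {f : (Fin n → Bool) → ℝ},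
    f ∈ lowDeg n k → ∃ P : MvPolynomial (Fin n) ℝ, P.totalDegree ≤ k ∧
      ∀ x, MvPolynomial.eval (vertex x) P = f x
  | 0, k, f, _ => ⟨MvPolynomial.C (f default), by simp, fun x => by
      rw [MvPolynomial.eval_C, Subsingleton.elim x default]⟩
  | n + 1, 0, f, hf => by
    rw [mem_lowDeg_succ_zero] at hf
    obtain ⟨P, hP, hPf⟩ := exists_polynomial_of_mem_lowDeg hf.1
    refine ⟨MvPolynomial.rename Fin.succ P, (MvPolynomial.totalDegree_rename_le _ _).trans hP,
      fun x => ?_⟩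
    rw [MvPolynomial.eval_rename, ← glue_face_diff f, hf.2]
    exact (hPf (Fin.tail x)).trans (by simp [glue])
  | n + 1, k + 1, f, hf => by
    rw [mem_lowDeg_succ_succ] at hf
    obtain ⟨P, hP, hPf⟩ := exists_polynomial_of_mem_lowDeg hf.1
    obtain ⟨Q, hQ, hQf⟩ := exists_polynomial_of_mem_lowDeg hf.2
    refine ⟨MvPolynomial.rename Fin.succ P + MvPolynomial.X 0 * MvPolynomial.rename Fin.succ Q,
      (MvPolynomial.totalDegree_add _ _).trans (max_le ?_ ?_), fun x => ?_⟩
    · exact (MvPolynomial.totalDegree_rename_le _ _).trans hP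
    · refine (MvPolynomial.totalDegree_mul _ _).trans ?_
      rw [MvPolynomial.totalDegree_X, add_comm]
      exact Nat.add_le_add_right ((MvPolynomial.totalDegree_rename_le _ _).trans hQ) 1
    · have hP' : MvPolynomial.eval (vertex x ∘ Fin.succ) P = face n false f (Fin.tail x) :=
        hPf (Fin.tail x)
      have hQ' : MvPolynomial.eval (vertex x ∘ Fin.succ) Q = diff n f (Fin.tail x) :=
        hQf (Fin.tail x)
      rw [map_add, map_mul, MvPolynomial.eval_rename, MvPolynomial.eval_rename,
        MvPolynomial.eval_X, hP', hQ']
      conv_rhs => rw [← glue_face_diff f]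
      simp only [glue, vertex, ite_mul, one_mul, zero_mul]

/-- `g` is a sum of squares of polynomials of degree at most `k`. -/
def IsSqSum {n : ℕ} (k : ℕ) (g : (Fin n → ℝ) → ℝ) : Prop :=
  ∃ (m : ℕ) (q : Fin m → MvPolynomial (Fin n) ℝ), (∀ i, (q i).totalDegree ≤ k) ∧
    ∀ x, g x = ∑ i, MvPolynomial.eval x (q i) ^ 2

theorem IsSqSum.zero {n k : ℕ} : IsSqSum k (0 : (Fin n → ℝ) → ℝ) :=
  ⟨0, Fin.elim0, fun i => i.elim0, fun x => by simp⟩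

theorem IsSqSum.sq {n k : ℕ} {P : MvPolynomial (Fin n) ℝ} (hP : P.totalDegree ≤ k) :
    IsSqSum k fun x => MvPolynomial.eval x P ^ 2 :=
  ⟨1, fun _ => P, fun _ => hP, fun x => by simp⟩

theorem IsSqSum.add {n k : ℕ} {g h : (Fin n → ℝ) → ℝ} (hg : IsSqSum k g) (hh : IsSqSum k h) :
    IsSqSum k (g + h) := by
  obtain ⟨m, q, hq, hgq⟩ := hg
  obtain ⟨l, r, hr, hhr⟩ := hh
  refine ⟨m + l, Fin.append q r, fun i => ?_, fun x => ?_⟩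
  · refine Fin.addCases (fun i => ?_) (fun i => ?_) i
    · rw [Fin.append_left]; exact hq i
    · rw [Fin.append_right]; exact hr i
  · simp [Fin.sum_univ_add, hgq, hhr]

theorem IsSqSum.smul {n k : ℕ} {g : (Fin n → ℝ) → ℝ} (hg : IsSqSum k g) {c : ℝ} (hc : 0 ≤ c) :
    IsSqSum k (c • g) := by
  obtain ⟨m, q, hq, hgq⟩ := hg
  refine ⟨m, fun i => √c • q i, fun i => (MvPolynomial.totalDegree_smul_le _ _).trans (hq i),
    fun x => ?_⟩
  simp [hgq, mul_sum, mul_pow, Real.sq_sqrt hc]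

theorem exists_linearMap_nonneg {α : Type*} (s : PointedCone ℝ (α → ℝ)) (hs : -1 ∉ s)
    (hdense : ∀ y, ∃ c : ℝ, c • 1 + y ∈ s) :
    ∃ g : (α → ℝ) →ₗ[ℝ] ℝ, g 1 = 1 ∧ ∀ y ∈ s, 0 ≤ g y := by
  have h1 : (1 : α → ℝ) ≠ 0 := fun h => hs (by rw [h, neg_zero]; exact zero_mem s)
  let f : (α → ℝ) →ₗ.[ℝ] ℝ := LinearPMap.mkSpanSingleton 1 1 h1
  have hf (c : ℝ) (h) : f ⟨c • 1, h⟩ = c := by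
    exact (LinearPMap.mkSpanSingleton'_apply (σ := RingHom.id ℝ) (1 : α → ℝ) (1 : ℝ) _ c h).trans
      (mul_one c)
  have hmem (c : ℝ) : c • (1 : α → ℝ) ∈ f.domain := Submodule.mem_span_singleton.2 ⟨c, rfl⟩
  obtain ⟨g, hgf, hg⟩ := riesz_extension s f
    (by
      rintro ⟨x, hx⟩ hxs
      obtain ⟨c, rfl⟩ := Submodule.mem_span_singleton.1 hx
      rw [hf]
      by_contra! hc
      refine hs ?_
      have h := s.smul_mem (inv_nonneg.2 (neg_nonneg.2 hc.le)) hxs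
      convert h using 1
      rw [smul_smul, inv_neg, neg_mul, inv_mul_cancel₀ hc.ne, neg_one_smul])
    (fun y => by
      obtain ⟨c, hc⟩ := hdense y
      exact ⟨⟨_, hmem c⟩, hc⟩)
  refine ⟨g, ?_, hg⟩
  simpa only [one_smul] using (hgf ⟨_, hmem 1⟩).trans (hf 1 _)

theorem exists_smul_one_add_mem {n k : ℕ} (hn : n ≤ k + k) (s : PointedCone ℝ ((Fin n → Bool) → ℝ))
    (hs : ∀ f ∈ lowDeg n k, f ^ 2 ∈ s) (y : (Fin n → Bool) → ℝ) : ∃ c : ℝ, c • 1 + y ∈ s := by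
  have key (e : Fin n → Bool) (t : ℝ) :
      |t| • (1 : (Fin n → Bool) → ℝ) + t • Pi.single e 1 ∈ s := by
    obtain ⟨a, ha, b, hb, ha2, hb2, hab⟩ := exists_idempotent_factors hn e
    have h1 := one_mem_lowDeg n k
    have h2 := add_mem (hs _ (sub_mem h1 ha)) (hs _ (sub_mem h1 hb))
    have hadd := add_mem (hs _ (add_mem ha hb)) h2
    have hsub := add_mem (hs _ (sub_mem ha hb)) h2
    rw [← hab]
    rcases le_total 0 t with ht | ht
    · rw [abs_of_nonneg ht]
      convert s.smul_mem (by positivity : 0 ≤ t / 2) hadd using 1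
      ext x
      have hax : a x ^ 2 = a x := congrFun ha2 x
      have hbx : b x ^ 2 = b x := congrFun hb2 x
      simp only [Pi.add_apply, Pi.smul_apply, Pi.one_apply, Pi.mul_apply, Pi.pow_apply,
        Pi.sub_apply, smul_eq_mul]
      linear_combination (-t) * (hax + hbx)
    · rw [abs_of_nonpos ht]
      convert s.smul_mem (by linarith : 0 ≤ -t / 2) hsub using 1
      ext x
      have hax : a x ^ 2 = a x := congrFun ha2 x
      have hbx : b x ^ 2 = b x := congrFun hb2 x
      simp only [Pi.add_apply, Pi.smul_apply, Pi.one_apply, Pi.mul_apply, Pi.pow_apply,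
        Pi.sub_apply, smul_eq_mul]
      linear_combination t * (hax + hbx)
  refine ⟨∑ e, |y e|, ?_⟩
  have h := sum_mem (t := univ) fun e _ => key e (y e)
  convert h using 1
  rw [sum_add_distrib, sum_smul]
  congr 1
  ext x
  simp [Pi.single_apply]

/-- A signed measure that is nonnegative on squares of functions of degree at most `b` and
nonpositive on `w`-weighted squares of functions of degree at most `a`, with `w` positive on the
support, is zero as soon as `n ≤ a + b`. -/
theorem weight_eq_zero {n a b : ℕ} (hn : n ≤ a + b) {w μ : (Fin n → Bool) → ℝ}
    (hw : ∀ x, μ x ≠ 0 → 0 < w x)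
    (hb : ∀ f ∈ lowDeg n b, 0 ≤ ∑ x, f x ^ 2 * μ x)
    (ha : ∀ f ∈ lowDeg n a, ∑ x, w x * f x ^ 2 * μ x ≤ 0) : μ = 0 := by
  classical
  by_contra hμ
  set Z : Finset (Fin n → Bool) := {x | μ x ≠ 0} with hZ
  set P : Finset (Fin n → Bool) := {x | 0 < μ x} with hP
  set N : Finset (Fin n → Bool) := {x | μ x < 0} with hN
  have hZne : Z.Nonempty := by
    obtain ⟨x, hx⟩ := Function.ne_iff.1 hμ
    exact ⟨x, by simpa [hZ] using hx⟩
  have hcard : #P + #N = #Z := by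
    rw [← card_union_of_disjoint]
    · congr 1
      ext x
      simp only [hZ, hP, hN, mem_union, mem_filter_univ, ne_iff_lt_or_gt, or_comm]
    · refine disjoint_left.2 fun x hx hx' => ?_
      simp only [hP, hN, mem_filter_univ] at hx hx'
      exact lt_asymm hx hx'
  have hPb : lowDeg n b ⊓ vanishing P ≤ lowDeg n b ⊓ vanishing Z := by
    refine fun f hf => ⟨hf.1, fun x hx => ?_⟩
    have hle (y) : f y ^ 2 * μ y ≤ 0 := by
      rcases le_or_gt (μ y) 0 with h | h
      · exact mul_nonpos_of_nonneg_of_nonpos (sq_nonneg _) h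
      · simp [hf.2 y (by simpa [hP] using h)]
    have h0 := (sum_eq_zero_iff_of_nonpos fun y _ => hle y).1
      (le_antisymm (sum_nonpos fun y _ => hle y) (hb f hf.1)) x (mem_univ x)
    have hx' : μ x ≠ 0 := by simpa [hZ] using hx
    simpa [hx'] using h0
  have hNa : lowDeg n a ⊓ vanishing N ≤ lowDeg n a ⊓ vanishing Z := by
    refine fun f hf => ⟨hf.1, fun x hx => ?_⟩
    have hle (y) : 0 ≤ w y * f y ^ 2 * μ y := by
      rcases lt_trichotomy (μ y) 0 with h | h | h
      · simp [hf.2 y (by simpa [hN] using h)]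
      · simp [h]
      · have := hw y h.ne'
        positivity
    have h0 := (sum_eq_zero_iff_of_nonneg fun y _ => hle y).1
      (le_antisymm (ha f hf.1) (sum_nonneg fun y _ => hle y)) x (mem_univ x)
    have hx' : μ x ≠ 0 := by simpa [hZ] using hx
    simpa [hx', (hw x hx').ne'] using h0
  have h1 := finrank_le_finrank_inf_vanishing (lowDeg n b) P
  have h2 := finrank_le_finrank_inf_vanishing (lowDeg n a) N
  have h3 : _ ≤ nullity b Z := Submodule.finrank_mono hPb
  have h4 : _ ≤ nullity a Z := Submodule.finrank_mono hNa
  have h5 := nullity_add_nullity_lt hn hZne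
  omega

/-- The cone of functions agreeing on `Y` with an element of the cone generated by the squares
of functions of degree at most `b` and the `-w`-weighted squares of functions of degree at most
`a`. -/
def multiplierCone {n : ℕ} (a b : ℕ) (w : (Fin n → Bool) → ℝ) (Y : Set (Fin n → Bool)) :
    PointedCone ℝ ((Fin n → Bool) → ℝ) :=
  PointedCone.hull ℝ ({y | ∃ f ∈ lowDeg n b, y = f ^ 2} ∪
    {y | ∃ f ∈ lowDeg n a, y = -(w * f ^ 2)} ∪ {y | ∀ x ∈ Y, y x = 0})

theorem neg_one_mem_multiplierCone {n a b : ℕ} (hn : n ≤ a + b) (hab : a ≤ b)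
    {w : (Fin n → Bool) → ℝ} {Y : Set (Fin n → Bool)} (hw : ∀ x ∈ Y, 0 < w x) :
    -1 ∈ multiplierCone a b w Y := by
  classical
  by_contra hneg
  have hsq : ∀ f ∈ lowDeg n b, f ^ 2 ∈ multiplierCone a b w Y := fun f hf =>
    PointedCone.subset_hull (Or.inl (Or.inl ⟨f, hf, rfl⟩))
  obtain ⟨g, hg1, hg⟩ := exists_linearMap_nonneg _ hneg
    (exists_smul_one_add_mem (by omega : n ≤ b + b) _ hsq)
  have hsum (y : (Fin n → Bool) → ℝ) : g y = ∑ x, y x * g (Pi.single x 1) := by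
    conv_lhs => rw [pi_eq_sum_univ' y]
    simp [map_sum]
  have hμ : (fun x => g (Pi.single x 1)) = 0 := by
    refine weight_eq_zero hn (w := w) (fun x hx => hw x ?_) (fun f hf => ?_) (fun f hf => ?_)
    · by_contra hxY
      have hz (c : ℝ) : (Pi.single x c : (Fin n → Bool) → ℝ) ∈ multiplierCone a b w Y :=
        PointedCone.subset_hull (Or.inr fun y hy =>
          by rw [Pi.single_eq_of_ne (ne_of_mem_of_not_mem hy hxY)])
      have h1 := hg _ (hz 1)
      have h2 := hg _ (hz (-1))
      rw [Pi.single_neg, map_neg] at h2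
      exact hx (by linarith)
    · have h := hg _ (hsq f hf)
      rwa [hsum] at h
    · have h := hg _ (PointedCone.subset_hull (Or.inl (Or.inr ⟨f, hf, rfl⟩)))
      rw [map_neg, hsum] at h
      exact neg_nonneg.1 h
  have h1 := hsum 1
  rw [hg1, sum_eq_zero fun x _ => by rw [congrFun hμ x, Pi.zero_apply, mul_zero]] at h1
  exact one_ne_zero h1

theorem exists_isSqSum_of_mem_multiplierCone {n a b : ℕ} {p : MvPolynomial (Fin n) ℝ}
    {Y : Set (Fin n → Bool)} {y : (Fin n → Bool) → ℝ}
    (hy : y ∈ multiplierCone a b (fun x => MvPolynomial.eval (vertex x) p) Y) :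
    ∃ u v : (Fin n → ℝ) → ℝ, IsSqSum b u ∧ IsSqSum a v ∧ ∀ x ∈ Y,
      y x = u (vertex x) - MvPolynomial.eval (vertex x) p * v (vertex x) := by
  refine Submodule.span_induction ?_ ?_ ?_ ?_ hy
  · rintro y ((⟨f, hf, rfl⟩ | ⟨f, hf, rfl⟩) | hy)
    · obtain ⟨P, hP, hPf⟩ := exists_polynomial_of_mem_lowDeg hf
      exact ⟨_, 0, IsSqSum.sq hP, IsSqSum.zero, fun x _ => by simp [hPf]⟩
    · obtain ⟨P, hP, hPf⟩ := exists_polynomial_of_mem_lowDeg hf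
      exact ⟨0, _, IsSqSum.zero, IsSqSum.sq hP, fun x _ => by simp [hPf]⟩
    · exact ⟨0, 0, IsSqSum.zero, IsSqSum.zero, fun x hx => by simp [hy x hx]⟩
  · exact ⟨0, 0, IsSqSum.zero, IsSqSum.zero, fun x hx => by simp⟩
  · rintro y z - - ⟨u, v, hu, hv, h⟩ ⟨u', v', hu', hv', h'⟩
    refine ⟨u + u', v + v', hu.add hu', hv.add hv', fun x hx => ?_⟩
    rw [Pi.add_apply, h x hx, h' x hx, Pi.add_apply, Pi.add_apply]
    ring
  · rintro c y - ⟨u, v, hu, hv, h⟩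
    refine ⟨(c : ℝ) • u, (c : ℝ) • v, hu.smul c.2, hv.smul c.2, fun x hx => ?_⟩
    have hc : (c • y) x = (c : ℝ) * y x := rfl
    rw [hc, h x hx, Pi.smul_apply, Pi.smul_apply, smul_eq_mul, smul_eq_mul]
    ring

end

theorem stmt5 (n d : ℕ) (hd : d = n / 2) (X : Set (Fin n → ℝ)) (hX : X ⊆ cube n)
    (p : MvPolynomial (Fin n) ℝ) (hdeg : p.totalDegree ≤ 2)
    (hpos : ∀ x ∈ X, 0 ≤ MvPolynomial.eval x p)
    (hne : ∃ x ∈ X, MvPolynomial.eval x p ≠ 0) :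
    ∃ (m l : ℕ) (q : Fin m → MvPolynomial (Fin n) ℝ)
      (s : Fin l → MvPolynomial (Fin n) ℝ),
      (∀ i, (q i).totalDegree ≤ d + 1) ∧ (∀ j, (s j).totalDegree ≤ d + 2) ∧
      ∀ x ∈ X, MvPolynomial.eval x p * (1 + ∑ i, (MvPolynomial.eval x (q i)) ^ 2) =
        ∑ j, (MvPolynomial.eval x (s j)) ^ 2 := by
  obtain ⟨u, v, ⟨m, q, hq, hu⟩, ⟨l, r, hr, hv⟩, h⟩ := exists_isSqSum_of_mem_multiplierCone <|
    neg_one_mem_multiplierCone (by omega : n ≤ d + (d + 1)) d.le_succ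
      (w := fun x => MvPolynomial.eval (vertex x) p)
      (Y := {x | vertex x ∈ X ∧ MvPolynomial.eval (vertex x) p ≠ 0})
      fun x hx => (hpos _ hx.1).lt_of_ne' hx.2
  refine ⟨m, l, q, fun j => p * r j, hq, fun j => ?_, fun x hx => ?_⟩
  · exact (MvPolynomial.totalDegree_mul p (r j)).trans (by linarith [hr j])
  · simp only [map_mul, mul_pow, ← Finset.mul_sum, ← hu, ← hv]
    obtain ⟨x, rfl⟩ := exists_vertex_eq (hX hx)
    by_cases hp : MvPolynomial.eval (vertex x) p = 0
    · simp [hp]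
    · have hx' := h x ⟨hx, hp⟩
      rw [Pi.neg_apply, Pi.one_apply] at hx'
      linear_combination (-MvPolynomial.eval (vertex x) p) * hx'
end
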